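/- arXiv:2205.05044 — 5 statements merged into one kernel-verified Lean document; each statement's English description precedes it below -/
import Mathlib

section
/- Let G be an m-sparse graph with exactly m(|V(G)|-1) edges. Then for every partition P of V(G), the number e_G(P) of edges joining different parts of P satisfies e_G(P) ≥ m(|P|-1) + p₀, where p₀ is the number of parts X ∈ P such that the induced subgraph G[X] is not m-tree-connected. -/
open SimpleGraph

def IsTreeConn {V : Type*} (m : ℕ) (G : SimpleGraph V) : Prop :=
  ∃ T : Fin m → SimpleGraph V, (∀ i, T i ≤ G) ∧ (∀ i, (T i).IsTree) ∧
    ∀ i j, i ≠ j → Disjoint (T i).edgeSet (T j).edgeSet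

noncomputable def eIn {V : Type*} (G : SimpleGraph V) (S : Set V) : ℕ :=
  {e ∈ G.edgeSet | ∀ v ∈ e, v ∈ S}.ncard

def IsSparse {V : Type*} (m : ℕ) (G : SimpleGraph V) : Prop :=
  ∀ S : Set V, S.Nonempty → (eIn G S : ℤ) ≤ m * S.ncard - m

def mComp {V : Type*} (m : ℕ) (G : SimpleGraph V) (v : V) : Set V :=
  ⋃₀ {X : Set V | v ∈ X ∧ IsTreeConn m (G.induce X)}

noncomputable def crossE {V : Type*} (m : ℕ) (G : SimpleGraph V) : ℕ :=
  {e ∈ G.edgeSet | ∃ u ∈ e, ∃ w ∈ e, mComp m G u ≠ mComp m G w}.ncard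

noncomputable def Omega {V : Type*} (m : ℕ) (G : SimpleGraph V) : ℤ :=
  m * (Set.range (mComp m G)).ncard - crossE m G

/-- The subgraph of `H` formed by the edges of colour `i` under a partial edge colouring `c`. -/
def colorGraph {W ι : Type*} (H : SimpleGraph W) (c : Sym2 W → Option ι) (i : ι) :
    SimpleGraph W where
  Adj x y := H.Adj x y ∧ c s(x, y) = some i
  symm := ⟨fun x y h => ⟨h.1.symm, Sym2.eq_swap (a := x) (b := y) ▸ h.2⟩⟩
  loopless := ⟨fun x h => H.loopless.irrefl x h.1⟩

def uncolored {W ι : Type*} (H : SimpleGraph W) (c : Sym2 W → Option ι) : Set (Sym2 W) :=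
  {e ∈ H.edgeSet | c e = none}

/-- A partial edge colouring with acyclic colour classes and as few uncoloured edges as possible. -/
structure IsOptimalColoring {W ι : Type*} (H : SimpleGraph W) (c : Sym2 W → Option ι) : Prop where
  acyclic : ∀ i, (colorGraph H c i).IsAcyclic
  minimal : ∀ c' : Sym2 W → Option ι, (∀ i, (colorGraph H c' i).IsAcyclic) →
    (uncolored H c).ncard ≤ (uncolored H c').ncard

/-- `c'` is an optimal colouring all of whose coloured edges, except possibly one uncoloured
by `c`, have the same colour under `c`. -/
def ExchangeStep {W ι : Type*} (H : SimpleGraph W) (c c' : Sym2 W → Option ι) : Prop :=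
  IsOptimalColoring H c' ∧ ∃ e, c e = none ∧ ∀ g ≠ e, ∀ j, c' g = some j → c g = some j

def exchangeableEdges {W ι : Type*} (H : SimpleGraph W) (c₀ : Sym2 W → Option ι) : Set (Sym2 W) :=
  {e ∈ H.edgeSet | ∃ c, Relation.ReflTransGen (ExchangeStep H) c₀ c ∧ c e = none}

lemma exists_isOptimalColoring {W ι : Type*} (H : SimpleGraph W) :
    ∃ c : Sym2 W → Option ι, IsOptimalColoring H c := by
  let S : Set (Sym2 W → Option ι) := {c | ∀ i, (colorGraph H c i).IsAcyclic}
  have hS : S.Nonempty := ⟨fun _ => none, fun i => by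
    have : colorGraph H (fun _ => (none : Option ι)) i = ⊥ := by
      ext x y
      simp [colorGraph]
    rw [this]
    exact isAcyclic_bot⟩
  let f : (Sym2 W → Option ι) → ℕ := fun c => (uncolored H c).ncard
  exact ⟨Function.argminOn f S hS, Function.argminOn_mem f S hS,
    fun c' hc' => Function.argminOn_le f S (a := c') hc'⟩

section Coloring

variable {W ι : Type*} [DecidableEq W] {H : SimpleGraph W} {c : Sym2 W → Option ι}

lemma colorGraph_update_some_le [DecidableEq ι] (u v : W) (i j : ι) :
    colorGraph H (Function.update c s(u, v) (some i)) j ≤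
      if j = i then colorGraph H c j ⊔ edge u v else colorGraph H c j := by
  intro x y h
  obtain ⟨h1, h2⟩ := h
  by_cases he : s(x, y) = s(u, v)
  · rw [he, Function.update_self] at h2
    obtain rfl : i = j := by simpa using h2
    rw [if_pos rfl]
    right
    simpa [edge, h1.ne] using he
  · rw [Function.update_of_ne he] at h2
    split_ifs
    · exact Or.inl ⟨h1, h2⟩
    · exact ⟨h1, h2⟩

lemma colorGraph_update_none (f : Sym2 W) (j : ι) :
    colorGraph H (Function.update c f none) j = (colorGraph H c j).deleteEdges {f} := by
  ext x y
  by_cases he : s(x, y) = f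
  · simp [colorGraph, he]
  · simp [colorGraph, he, Function.update_of_ne]

lemma isAcyclic_colorGraph_update_some (hc : ∀ j, (colorGraph H c j).IsAcyclic) {u v : W} {i : ι}
    (h : ¬ (colorGraph H c i).Reachable u v) (j : ι) :
    (colorGraph H (Function.update c s(u, v) (some i)) j).IsAcyclic := by
  classical
  refine IsAcyclic.anti (colorGraph_update_some_le u v i j) ?_
  split_ifs with hij
  · subst hij
    exact (hc j).sup_edge_of_not_reachable h
  · exact hc j

variable [Finite W]

/-- In an optimal colouring every colour class joins the ends of an uncoloured edge. -/
lemma IsOptimalColoring.reachable (hc : IsOptimalColoring H c) {u v : W} (huv : H.Adj u v)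
    (he : c s(u, v) = none) (i : ι) : (colorGraph H c i).Reachable u v := by
  by_contra h
  have hle := hc.minimal _ (isAcyclic_colorGraph_update_some hc.acyclic h)
  refine hle.not_gt (Set.ncard_lt_ncard ⟨fun g hg => ⟨hg.1, ?_⟩, fun hsub => ?_⟩ (Set.toFinite _))
  · by_cases hge : g = s(u, v)
    · rw [hge, he]
    · simpa [Function.update_of_ne hge] using hg.2
  · simpa using (hsub (⟨huv, he⟩ : s(u, v) ∈ uncolored H c)).2

/-- Exchanging an uncoloured edge with an edge on the path joining its ends in a colour class. -/
lemma IsOptimalColoring.exists_exchangeStep (hc : IsOptimalColoring H c) {u v : W}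
    (huv : H.Adj u v) (he : c s(u, v) = none) {i : ι} {p : (colorGraph H c i).Walk u v}
    (hp : p.IsPath) {f : Sym2 W} (hf : f ∈ p.edges) :
    ∃ c', ExchangeStep H c c' ∧ c' f = none := by
  have hfi : c f = some i := by
    have := p.edges_subset_edgeSet hf
    induction f with | h x y => exact this.2
  have hfe : f ≠ s(u, v) := by
    rintro rfl
    simp [he] at hfi
  have hdel : ∀ j, (colorGraph H (Function.update c f none) j).IsAcyclic := fun j => by
    rw [colorGraph_update_none]
    exact (hc.acyclic j).anti (deleteEdges_le _)
  have hnr : ¬ (colorGraph H (Function.update c f none) i).Reachable u v := by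
    rw [colorGraph_update_none]
    rintro ⟨q⟩
    have hle := (colorGraph H c i).deleteEdges_le {f}
    have hq : (q.toPath : ((colorGraph H c i).deleteEdges {f}).Walk u v).mapLe hle = p := by
      have := (hc.acyclic i).subsingleton_path u v
      exact congrArg Subtype.val <| Subsingleton.elim
        (⟨(q.toPath : ((colorGraph H c i).deleteEdges {f}).Walk u v).mapLe hle,
          q.toPath.2.mapLe hle⟩ : (colorGraph H c i).Path u v) ⟨p, hp⟩
    rw [← hq, Walk.edges_mapLe_eq_edges] at hf
    have := Walk.edges_subset_edgeSet _ hf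
    simp at this
  refine ⟨Function.update (Function.update c f none) s(u, v) (some i), ⟨⟨?_, ?_⟩, s(u, v), he, ?_⟩,
    by simp [Function.update_of_ne hfe]⟩
  · exact isAcyclic_colorGraph_update_some hdel hnr
  · intro c' hc'
    refine le_trans ?_ (hc.minimal c' hc')
    have hmem : s(u, v) ∈ uncolored H c := ⟨huv, he⟩
    refine (Set.ncard_le_ncard (t := insert f (uncolored H c \ {s(u, v)})) ?_
      (Set.toFinite _)).trans ?_
    · rintro g ⟨hg, hgn⟩
      by_cases hge : g = s(u, v)
      · simp [hge] at hgn
      · rw [Function.update_of_ne hge] at hgn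
        by_cases hgf : g = f
        · exact Or.inl hgf
        · rw [Function.update_of_ne hgf] at hgn
          exact Or.inr ⟨⟨hg, hgn⟩, hge⟩
    · exact (Set.ncard_insert_le _ _).trans
        (Set.ncard_sdiff_singleton_add_one hmem (Set.toFinite _)).le
  · intro g hge j hg
    rw [Function.update_of_ne hge] at hg
    by_cases hgf : g = f
    · simp [hgf] at hg
    · rwa [Function.update_of_ne hgf] at hg

variable {c₀ : Sym2 W → Option ι}

lemma reachable_exchangeableEdges_of_uncolored (hc : IsOptimalColoring H c)
    (hr : Relation.ReflTransGen (ExchangeStep H) c₀ c) {u v : W} (huv : H.Adj u v)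
    (he : c s(u, v) = none) (i : ι) :
    (colorGraph H c i ⊓ fromEdgeSet (exchangeableEdges H c₀)).Reachable u v := by
  obtain ⟨p, hp⟩ := (hc.reachable huv he i).exists_isPath
  refine ⟨p.transfer _ fun f hf => ?_⟩
  have hfc := p.edges_subset_edgeSet hf
  obtain ⟨c', hs, hn⟩ := hc.exists_exchangeStep huv he hp hf
  induction f with
  | h x y =>
    exact ⟨hfc, (fromEdgeSet_adj _).2 ⟨⟨hfc.1, c', hr.tail hs, hn⟩, hfc.1.ne⟩⟩

lemma reachable_exchangeableEdges_of_exchangeStep (hc₀ : IsOptimalColoring H c₀)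
    (hr : Relation.ReflTransGen (ExchangeStep H) c₀ c) (i : ι) {x y : W}
    (h : (colorGraph H c i ⊓ fromEdgeSet (exchangeableEdges H c₀)).Reachable x y) :
    (colorGraph H c₀ i ⊓ fromEdgeSet (exchangeableEdges H c₀)).Reachable x y := by
  induction hr generalizing x y with
  | refl => exact h
  | @tail b d hb hs ih =>
    have hbo : IsOptimalColoring H b := by
      rcases Relation.ReflTransGen.cases_tail hb with rfl | ⟨_, _, h'⟩
      · exact hc₀
      · exact h'.1
    obtain ⟨-, e, he, hcol⟩ := hs
    obtain ⟨p⟩ := h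
    induction p with
    | nil => exact Reachable.refl _
    | @cons x y z hxy p ihp =>
      refine Reachable.trans (ih ?_) ihp
      by_cases hxe : s(x, y) = e
      · exact reachable_exchangeableEdges_of_uncolored hbo hb hxy.1.1 (hxe ▸ he) i
      · exact Adj.reachable ⟨⟨hxy.1.1, hcol _ hxe i hxy.1.2⟩, hxy.2⟩

/-- In an optimal colouring, the exchangeable edges of each colour span all exchangeable edges. -/
lemma reachable_of_mem_exchangeableEdges (hc₀ : IsOptimalColoring H c₀) {u v : W}
    (h : s(u, v) ∈ exchangeableEdges H c₀) (i : ι) :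
    (colorGraph H c₀ i ⊓ fromEdgeSet (exchangeableEdges H c₀)).Reachable u v := by
  obtain ⟨huv, c, hr, he⟩ := h
  have hc : IsOptimalColoring H c := by
    rcases Relation.ReflTransGen.cases_tail hr with rfl | ⟨_, _, h'⟩
    · exact hc₀
    · exact h'.1
  exact reachable_exchangeableEdges_of_exchangeStep hc₀ hr i
    (reachable_exchangeableEdges_of_uncolored hc hr huv he i)

end Coloring

lemma eIn_eq_ncard_edgeSet_induce {V : Type*} (G : SimpleGraph V) (S : Set V) :
    eIn G S = (G.induce S).edgeSet.ncard := by
  rw [← Set.ncard_image_of_injective _ (Sym2.map.injective Subtype.val_injective), eIn]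
  congr 1
  ext e
  induction e with | h x y => ?_
  constructor
  · rintro ⟨he, hS⟩
    exact ⟨s(⟨x, hS x (by simp)⟩, ⟨y, hS y (by simp)⟩), he, by simp⟩
  · rintro ⟨f, hf, hfe⟩
    induction f with | h a b => ?_
    rw [← hfe]
    refine ⟨hf, ?_⟩
    simp

lemma ncard_le_eIn_add_one {V : Type*} [Finite V] (G : SimpleGraph V) {S : Set V}
    (h : (G.induce S).Connected) : S.ncard ≤ eIn G S + 1 := by
  rw [eIn_eq_ncard_edgeSet_induce]
  exact h.card_vert_le_card_edgeSet_add_one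

lemma sum_eIn_colorGraph {W : Type*} [Finite W] {m : ℕ} (H : SimpleGraph W)
    (c : Sym2 W → Option (Fin m)) (S : Set W) :
    ∑ i, eIn (colorGraph H c i) S + {e ∈ uncolored H c | ∀ v ∈ e, v ∈ S}.ncard = eIn H S := by
  classical
  have := Fintype.ofFinite W
  have key : ∀ o : Option (Fin m), {e ∈ H.edgeSet | (∀ v ∈ e, v ∈ S) ∧ c e = o}.ncard =
      (({e : Sym2 W | e ∈ H.edgeSet ∧ ∀ v ∈ e, v ∈ S} : Finset (Sym2 W)).filter
        (fun e => c e = o)).card := by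
    intro o
    rw [← Set.ncard_coe_finset]
    congr 1
    ext e
    simp [and_assoc]
  have hS : eIn H S = ({e : Sym2 W | e ∈ H.edgeSet ∧ ∀ v ∈ e, v ∈ S} : Finset (Sym2 W)).card := by
    rw [← Set.ncard_coe_finset, eIn]
    congr 1
    ext e
    simp
  rw [hS, Finset.card_eq_sum_card_fiberwise (f := c) (t := Finset.univ) (fun _ _ => by simp),
    Fintype.sum_option, add_comm]
  congr 1
  · rw [← key]
    congr 1
    ext e
    simp only [uncolored, Set.mem_ofPred_eq]
    tauto
  · refine Finset.sum_congr rfl fun i _ => ?_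
    rw [← key, eIn]
    congr 1
    ext e
    induction e with | h x y => ?_
    simp only [Set.mem_ofPred_eq, mem_edgeSet, colorGraph]
    tauto

/-- The edges of a sparse graph can be partitioned into `m` forests. -/
lemma IsSparse.exists_forest_coloring {W : Type*} [Finite W] {m : ℕ} {H : SimpleGraph W}
    (hs : IsSparse m H) : ∃ c : Sym2 W → Option (Fin m),
      (∀ i, (colorGraph H c i).IsAcyclic) ∧ uncolored H c = ∅ := by
  classical
  obtain ⟨c, hc⟩ := exists_isOptimalColoring (ι := Fin m) H
  refine ⟨c, hc.acyclic, Set.eq_empty_iff_forall_notMem.2 fun e he => ?_⟩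
  induction e with | h u v => ?_
  have huv : s(u, v) ∈ exchangeableEdges H c := ⟨he.1, c, .refl, he.2⟩
  let B := fromEdgeSet (exchangeableEdges H c)
  let U : Set W := {w | B.Reachable u w}
  have hB : ∀ i x w, B.Reachable x w → (colorGraph H c i ⊓ B).Reachable x w := by
    rintro i x w ⟨p⟩
    induction p with
    | nil => exact .refl _
    | cons h p ih =>
      exact (reachable_of_mem_exchangeableEdges hc ((fromEdgeSet_adj _).1 h).1 i).trans ih
  have huU : u ∈ U := Reachable.refl u
  have hvU : v ∈ U := Adj.reachable ((fromEdgeSet_adj _).2 ⟨huv, Adj.ne he.1⟩)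
  have hconn : ∀ i, ((colorGraph H c i).induce U).Connected := by
    intro i
    have hU : U = ((colorGraph H c i ⊓ B).connectedComponentMk u).supp := by
      ext w
      rw [ConnectedComponent.mem_supp_iff, ConnectedComponent.eq]
      exact ⟨fun h => (hB i u w h).symm, fun h => (h.mono inf_le_right).symm⟩
    have := ((colorGraph H c i ⊓ B).connectedComponentMk u).connected_toSimpleGraph
    rw [hU]
    exact this.mono (comap_monotone _ inf_le_left)
  have hcard : ∀ i ∈ Finset.univ, (U.ncard : ℤ) - 1 ≤ eIn (colorGraph H c i) U := by
    intro i _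
    have := ncard_le_eIn_add_one _ (hconn i)
    lia
  have hsum := Finset.sum_le_sum hcard
  have hpos : 0 < {e ∈ uncolored H c | ∀ v ∈ e, v ∈ U}.ncard := by
    refine (Set.ncard_pos (Set.toFinite _)).2 ⟨s(u, v), he, ?_⟩
    simp [huU, hvU]
  have htot := sum_eIn_colorGraph H c U
  have hU := hs U ⟨u, huU⟩
  simp only [Finset.sum_const, Finset.card_univ, Fintype.card_fin, nsmul_eq_mul] at hsum
  zify at htot hpos
  linarith

lemma IsSparse.isTreeConn {W : Type*} [Finite W] [Nonempty W] {m : ℕ} {H : SimpleGraph W}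
    (hs : IsSparse m H) (he : (H.edgeSet.ncard : ℤ) = m * (Nat.card W : ℤ) - m) :
    IsTreeConn m H := by
  obtain ⟨c, hac, hun⟩ := hs.exists_forest_coloring
  have huniv : ∀ G : SimpleGraph W, eIn G Set.univ = G.edgeSet.ncard := fun G => by simp [eIn]
  choose T hT hTtree using fun i => (connected_top (V := W)).exists_isTree_le_of_le_of_isAcyclic
    le_top (hac i)
  have hTcard : ∀ i, ((T i).edgeSet.ncard : ℤ) = Nat.card W - 1 := fun i => by
    have := (isTree_iff_connected_and_card.1 (hTtree i).2).2
    rw [Nat.card_coe_set_eq] at this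
    lia
  have hle : ∀ i ∈ Finset.univ, ((colorGraph H c i).edgeSet.ncard : ℤ) ≤ (T i).edgeSet.ncard :=
    fun i _ => by exact_mod_cast Set.ncard_le_ncard (edgeSet_mono (hT i)) (Set.toFinite _)
  have hsum : ∑ i, ((colorGraph H c i).edgeSet.ncard : ℤ) = ∑ i, ((T i).edgeSet.ncard : ℤ) := by
    have := sum_eIn_colorGraph H c Set.univ
    simp only [huniv, hun, Set.mem_empty_iff_false, false_and, Set.ofPred_false,
      Set.ncard_empty, add_zero] at this
    simp only [hTcard, Finset.sum_const, Finset.card_univ, Fintype.card_fin, nsmul_eq_mul]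
    zify at this
    linarith
  have heq := (Finset.sum_eq_sum_iff_of_le hle).1 hsum
  refine ⟨colorGraph H c, fun i x y h => h.1, fun i => ?_, fun i j hij => ?_⟩
  · have : (colorGraph H c i).edgeSet = (T i).edgeSet :=
      Set.eq_of_subset_of_ncard_le (edgeSet_mono (hT i))
        (by exact_mod_cast (heq i (Finset.mem_univ i)).ge) (Set.toFinite _)
    rw [edgeSet_inj.1 this]
    exact (hTtree i).2
  · refine Set.disjoint_left.2 fun e => ?_
    induction e with | h x y => ?_
    intro h h'
    exact hij (Option.some_injective _ (h.2.symm.trans h'.2))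

lemma IsSparse.induce {V : Type*} {m : ℕ} {G : SimpleGraph V} (hs : IsSparse m G) (X : Set V) :
    IsSparse m (G.induce X) := by
  intro S hS
  have := hs (Subtype.val '' S) (hS.image _)
  rw [Set.ncard_image_of_injective _ Subtype.val_injective] at this
  convert this using 2
  rw [eIn, eIn, ← Set.ncard_image_of_injective _ (Sym2.map.injective Subtype.val_injective)]
  congr 1
  ext e
  constructor
  · rintro ⟨f, ⟨hf, hfS⟩, rfl⟩
    induction f with | h a b => ?_
    refine ⟨hf, ?_⟩
    simpa using hfS
  · induction e with | h x y => ?_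
    rintro ⟨he, h⟩
    obtain ⟨a, ha, rfl⟩ := h x (by simp)
    obtain ⟨b, hb, rfl⟩ := h y (by simp)
    exact ⟨s(a, b), ⟨he, by simp [ha, hb]⟩, by simp⟩

open Classical in
lemma IsSparse.eIn_add_le {V : Type*} [Finite V] {m : ℕ} {G : SimpleGraph V} (hs : IsSparse m G)
    {X : Set V} (hX : X.Nonempty) :
    (eIn G X : ℤ) + (if IsTreeConn m (G.induce X) then 0 else 1) ≤ m * X.ncard - m := by
  have hle := hs X hX
  split_ifs with h
  · simpa using hle
  · refine Int.add_one_le_of_lt (lt_of_le_of_ne hle fun heq => h ?_)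
    have := hX.to_subtype
    refine (hs.induce X).isTreeConn ?_
    rwa [← eIn_eq_ncard_edgeSet_induce, Nat.card_coe_set_eq]

lemma sum_eIn_parts_add_crossing {V : Type*} [Fintype V] [DecidableEq V] (G : SimpleGraph V)
    (P : Finpartition (Finset.univ : Finset V)) :
    ∑ A ∈ P.parts, eIn G (A : Set V) +
      {e ∈ G.edgeSet | ¬ ∃ A ∈ P.parts, ∀ v ∈ e, v ∈ A}.ncard = G.edgeSet.ncard := by
  classical
  have hsum : ∑ A ∈ P.parts, eIn G (A : Set V) =
      {e ∈ G.edgeSet | ∃ A ∈ P.parts, ∀ v ∈ e, v ∈ A}.ncard := by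
    have hu : {e ∈ G.edgeSet | ∃ A ∈ P.parts, ∀ v ∈ e, v ∈ A} =
        ((P.parts.biUnion fun A => {e : Sym2 V | e ∈ G.edgeSet ∧ ∀ v ∈ e, v ∈ A} :
          Finset (Sym2 V)) : Set (Sym2 V)) := by
      ext e
      simp only [Set.mem_ofPred_eq, Finset.coe_biUnion, Finset.coe_filter, Finset.mem_univ,
        true_and, Set.mem_iUnion, Finset.mem_coe]
      tauto
    rw [hu, Set.ncard_coe_finset, Finset.card_biUnion]
    · refine Finset.sum_congr rfl fun A _ => ?_
      rw [← Set.ncard_coe_finset, eIn]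
      congr 1
      ext e
      simp
    · intro A hA B hB hAB
      refine Finset.disjoint_left.2 fun e => ?_
      induction e with | h x y => ?_
      intro h h'
      simp only [Finset.mem_filter, Finset.mem_univ, true_and] at h h'
      exact Finset.disjoint_left.1 (P.disjoint hA hB hAB) (h.2 x (by simp)) (h'.2 x (by simp))
  rw [hsum, ← Set.ncard_inter_add_ncard_sdiff_eq_ncard G.edgeSet
    {e | ∃ A ∈ P.parts, ∀ v ∈ e, v ∈ A} (Set.toFinite _)]
  rfl

theorem stmt2 {V : Type*} [Fintype V] [DecidableEq V] [Nonempty V]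
    (m : ℕ) (hm : 0 < m) (G : SimpleGraph V)
    (hs : IsSparse m G)
    (he : (G.edgeSet.ncard : ℤ) = m * ((Fintype.card V : ℤ) - 1))
    (P : Finpartition (Finset.univ : Finset V)) :
    (m : ℤ) * ((P.parts.card : ℤ) - 1) +
      ({A ∈ (P.parts : Set (Finset V)) | ¬ IsTreeConn m (G.induce (↑A : Set V))}.ncard : ℤ) ≤
      ({e ∈ G.edgeSet | ¬ ∃ A ∈ P.parts, ∀ v ∈ e, v ∈ A}.ncard : ℤ) := by
  classical
  have hcount : ({A ∈ (P.parts : Set (Finset V)) |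
      ¬ IsTreeConn m (G.induce (↑A : Set V))}.ncard : ℤ) =
      ∑ A ∈ P.parts, if IsTreeConn m (G.induce (↑A : Set V)) then (0 : ℤ) else 1 := by
    have : {A ∈ (P.parts : Set (Finset V)) | ¬ IsTreeConn m (G.induce (↑A : Set V))} =
        ((P.parts.filter fun A : Finset V => ¬ IsTreeConn m (G.induce (↑A : Set V)) :
          Finset (Finset V)) : Set (Finset V)) := by
      ext A
      simp
    rw [this, Set.ncard_coe_finset, Finset.card_filter]
    push_cast
    exact Finset.sum_congr rfl fun A _ => by split_ifs <;> simp_all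
  have hparts := Finset.sum_le_sum (s := P.parts) fun (A : Finset V) hA =>
    hs.eIn_add_le (X := (A : Set V)) (Finset.coe_nonempty.2 (P.nonempty_of_mem_parts hA))
  have hcard : ∑ A ∈ P.parts, (A.card : ℤ) = Fintype.card V := by
    exact_mod_cast P.sum_card_parts
  have htot := sum_eIn_parts_add_crossing G P
  simp only [Set.ncard_coe_finset, Finset.sum_add_distrib, Finset.sum_sub_distrib,
    ← Finset.mul_sum, hcard, Finset.sum_const, nsmul_eq_mul] at hparts
  zify at htot
  linarith
end

section
/- For every graph G and every edge e of G, one has m ≤ Ω_m(G) ≤ Ω_m(G - e) ≤ Ω_m(G) + 1. Moreover, Ω_m(G) = m if and only if G is m-tree-connected. -/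
open SimpleGraph

/-- The part of `H` lying inside `U`, as a graph on the same vertex type. -/
def insideGraph {V : Type*} (H : SimpleGraph V) (U : Set V) : SimpleGraph V where
  Adj u v := H.Adj u v ∧ u ∈ U ∧ v ∈ U
  symm := ⟨fun _ _ h => ⟨h.1.symm, h.2.2, h.2.1⟩⟩
  loopless := ⟨fun _ h => h.1.ne rfl⟩

/-- `X` carries `m` edge-disjoint connected spanning subgraphs of `G`. -/
def SpanConn {V : Type*} (m : ℕ) (G : SimpleGraph V) (X : Set V) : Prop :=
  ∃ T : Fin m → SimpleGraph V, (∀ i, T i ≤ G) ∧ (∀ i u v, (T i).Adj u v → u ∈ X ∧ v ∈ X) ∧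
    (∀ i j u v, (T i).Adj u v → (T j).Adj u v → i = j) ∧
    ∀ i, ∀ u ∈ X, ∀ v ∈ X, (T i).Reachable u v

/-- The edge set `A` is covered by `m` forests. -/
def ForestCover {V : Type*} (m : ℕ) (A : Set (Sym2 V)) : Prop :=
  ∃ F : Fin m → SimpleGraph V, (∀ i, (F i).IsAcyclic) ∧ A ⊆ ⋃ i, (F i).edgeSet

/-- The states reachable from `(F₀, e₀)` by exchanges: the uncovered edge `s(x, y)` enters the
forest `F i`, and an edge of the path of `F i` joining its ends becomes uncovered. -/
inductive Exchange {V : Type*} {m : ℕ} (F₀ : Fin m → SimpleGraph V) (e₀ : Sym2 V) :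
    (Fin m → SimpleGraph V) → Sym2 V → Prop
  | start : Exchange F₀ e₀ F₀ e₀
  | step {F : Fin m → SimpleGraph V} {x y : V} {f : Sym2 V} (i : Fin m) (p : (F i).Walk x y)
      (hp : p.IsPath) (hf : f ∈ p.edges) (h : Exchange F₀ e₀ F s(x, y)) :
      Exchange F₀ e₀ (Function.update F i ((F i).deleteEdges {f} ⊔ edge x y)) f

theorem reachable_of_adj_reachable {V : Type*} {H K : SimpleGraph V}
    (h : ∀ u v, H.Adj u v → K.Reachable u v) {u v : V} (huv : H.Reachable u v) :
    K.Reachable u v := by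
  obtain ⟨p⟩ := huv
  induction p with
  | nil => rfl
  | cons a _ ih => exact (h _ _ a).trans ih

theorem apply_eq_of_reachable {V α : Type*} {H : SimpleGraph V} {f : V → α}
    (h : ∀ u v, H.Adj u v → f u = f v) {u v : V} (huv : H.Reachable u v) : f u = f v := by
  obtain ⟨p⟩ := huv
  induction p with
  | nil => rfl
  | cons a _ ih => exact (h _ _ a).trans ih

theorem insideGraph_reachable_of_inf {V : Type*} {H R : SimpleGraph V} {x u v : V}
    (hu : R.Reachable x u) (huv : (H ⊓ R).Reachable u v) :
    (insideGraph H {w | R.Reachable x w}).Reachable u v := by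
  obtain ⟨p⟩ := huv
  induction p with
  | nil => rfl
  | cons a _ ih =>
    have h := hu.trans a.2.reachable
    exact (show (insideGraph H _).Adj _ _ from ⟨a.1, hu, h⟩).reachable.trans (ih h)

theorem SimpleGraph.IsAcyclic.exchange {V : Type*} {H : SimpleGraph V} (hH : H.IsAcyclic) {x y : V}
    (p : H.Walk x y) (hp : p.IsPath) {f : Sym2 V} (hf : f ∈ p.edges) :
    (H.deleteEdges {f} ⊔ edge x y).IsAcyclic := by
  classical
  refine (hH.anti (deleteEdges_le _)).sup_edge_of_not_reachable ?_
  intro h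
  obtain ⟨q, hq⟩ := h.exists_isPath
  have hle := deleteEdges_le (G := H) {f}
  have hpq : p = q.mapLe hle := congrArg Subtype.val
    ((hH.subsingleton_path x y).elim ⟨p, hp⟩ ⟨q.mapLe hle, hq.mapLe hle⟩)
  rw [hpq, Walk.edges_mapLe_eq_edges] at hf
  have := q.edges_subset_edgeSet hf
  simp at this

namespace Exchange

variable {V : Type*} {m : ℕ} {F₀ F : Fin m → SimpleGraph V} {e₀ e : Sym2 V}

theorem isAcyclic (h : Exchange F₀ e₀ F e) (h₀ : ∀ i, (F₀ i).IsAcyclic) (j : Fin m) :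
    (F j).IsAcyclic := by
  induction h generalizing j with
  | start => exact h₀ j
  | step i p hp hf h ih =>
    rcases eq_or_ne j i with rfl | hj
    · simpa using (ih j).exchange p hp hf
    · simpa [Function.update_of_ne hj] using ih j

theorem not_isDiag (h : Exchange F₀ e₀ F e) (h₀ : ¬ e₀.IsDiag) : ¬ e.IsDiag := by
  cases h with
  | start => exact h₀
  | step i p hp hf h => exact not_isDiag_of_mem_edgeSet _ (p.edges_subset_edgeSet hf)

theorem subset (h : Exchange F₀ e₀ F e) (h₀ : ¬ e₀.IsDiag) :
    insert e₀ (⋃ i, (F₀ i).edgeSet) ⊆ insert e (⋃ i, (F i).edgeSet) := by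
  induction h with
  | start => exact subset_rfl
  | @step F x y f i p hp hf h ih =>
    intro g hg
    have hxy : x ≠ y := by simpa using h.not_isDiag h₀
    by_cases hgf : g = f
    · exact Or.inl hgf
    refine Or.inr (Set.mem_iUnion.2 ?_)
    rcases ih hg with rfl | hg
    · exact ⟨i, by simp [hxy]⟩
    · obtain ⟨j, hj⟩ := Set.mem_iUnion.1 hg
      rcases eq_or_ne j i with rfl | hji
      · exact ⟨j, by simp [hj, hgf]⟩
      · exact ⟨j, by simpa [Function.update_of_ne hji] using hj⟩

/-- The graph of all edges that can become uncovered. -/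
def edgeGraph (F₀ : Fin m → SimpleGraph V) (e₀ : Sym2 V) : SimpleGraph V :=
  fromEdgeSet {e | ∃ F, Exchange F₀ e₀ F e}

theorem inf_edgeGraph_reachable {x y : V} (h : Exchange F₀ e₀ F s(x, y)) {i : Fin m}
    (hr : (F i).Reachable x y) : (F i ⊓ edgeGraph F₀ e₀).Reachable x y := by
  classical
  obtain ⟨p, hp⟩ := hr.exists_isPath
  refine ⟨p.transfer _ fun f hf => ?_⟩
  have hfF := p.edges_subset_edgeSet hf
  rw [edgeSet_inf]
  refine ⟨hfF, ?_⟩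
  rw [edgeGraph, edgeSet_fromEdgeSet]
  exact ⟨⟨_, h.step i p hp hf⟩, not_isDiag_of_mem_edgeSet _ hfF⟩

theorem reachable_initial (h : Exchange F₀ e₀ F e) {i : Fin m} {u v : V}
    (huv : (F i ⊓ edgeGraph F₀ e₀).Adj u v) : (F₀ i ⊓ edgeGraph F₀ e₀).Reachable u v := by
  induction h generalizing i u v with
  | start => exact huv.reachable
  | @step F x y f j p hp hf h ih =>
    rcases eq_or_ne i j with rfl | hij
    · have hxy := reachable_of_adj_reachable (fun _ _ => ih) (h.inf_edgeGraph_reachable p.reachable)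
      obtain ⟨h1, h2⟩ := huv
      rw [Function.update_self] at h1
      rcases h1 with h1 | h1
      · exact ih ⟨deleteEdges_le _ h1, h2⟩
      · rw [edge_adj] at h1
        rcases h1.1 with ⟨rfl, rfl⟩ | ⟨rfl, rfl⟩
        · exact hxy
        · exact hxy.symm
    · rw [Function.update_of_ne hij] at huv
      exact ih huv

end Exchange

/-- If a further edge cannot be accommodated in a family of forests, its ends lie in a set on which
every forest of the family is connected. -/
theorem exists_connected_of_not_forestCover {V : Type*} {m : ℕ} {F : Fin m → SimpleGraph V}
    (hF : ∀ i, (F i).IsAcyclic) {x y : V} (hxy : x ≠ y)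
    (hcov : ¬ ForestCover m (insert s(x, y) (⋃ i, (F i).edgeSet))) :
    ∃ U : Set V, x ∈ U ∧ y ∈ U ∧ ∀ i, ∀ u ∈ U, ∀ v ∈ U, (insideGraph (F i) U).Reachable u v := by
  classical
  set R := Exchange.edgeGraph F s(x, y) with hR
  have hdiag : ¬ s(x, y).IsDiag := by simpa using hxy
  have hadj : ∀ i u v, R.Adj u v → (F i ⊓ R).Reachable u v := by
    intro i u v huv
    obtain ⟨⟨F', h⟩, huv⟩ := (fromEdgeSet_adj _).1 huv
    have hr : (F' i).Reachable u v := by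
      by_contra hr
      refine hcov ⟨Function.update F' i (F' i ⊔ edge u v), fun j => ?_, fun g hg => ?_⟩
      · rcases eq_or_ne j i with rfl | hj
        · simpa using (h.isAcyclic hF j).sup_edge_of_not_reachable hr
        · simpa [Function.update_of_ne hj] using h.isAcyclic hF j
      · refine Set.mem_iUnion.2 ?_
        rcases h.subset hdiag hg with rfl | hg
        · exact ⟨i, by simp [huv]⟩
        · obtain ⟨j, hj⟩ := Set.mem_iUnion.1 hg
          rcases eq_or_ne j i with rfl | hji
          · exact ⟨j, by simp [hj]⟩
          · exact ⟨j, by simpa [Function.update_of_ne hji] using hj⟩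
    exact reachable_of_adj_reachable (fun _ _ => h.reachable_initial)
      (h.inf_edgeGraph_reachable hr)
  refine ⟨{w | R.Reachable x w}, Reachable.refl x, ?_, fun i u hu v hv => ?_⟩
  · exact ((fromEdgeSet_adj _).2 ⟨⟨F, .start⟩, hxy⟩ : R.Adj x y).reachable
  · exact insideGraph_reachable_of_inf hu
      (reachable_of_adj_reachable (hadj i) (hu.symm.trans hv))

theorem ForestCover.exists_partition {V : Type*} {m : ℕ} {A : Set (Sym2 V)}
    (h : ForestCover m A) : ∃ F : Fin m → SimpleGraph V, (∀ i, (F i).IsAcyclic) ∧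
      (⋃ i, (F i).edgeSet) = A ∧ ∀ i j u v, (F i).Adj u v → (F j).Adj u v → i = j := by
  obtain ⟨F, hF, hA⟩ := h
  choose c hc using fun e : A => Set.mem_iUnion.1 (hA e.2)
  refine ⟨fun i => fromEdgeSet {e | ∃ h : e ∈ A, c ⟨e, h⟩ = i}, fun i => (hF i).anti ?_, ?_, ?_⟩
  · intro u v huv
    obtain ⟨⟨h, rfl⟩, -⟩ := (fromEdgeSet_adj _).1 huv
    exact hc ⟨s(u, v), h⟩
  · ext e
    simp only [Set.mem_iUnion, edgeSet_fromEdgeSet]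
    constructor
    · rintro ⟨i, ⟨h, -⟩, -⟩
      exact h
    · exact fun h => ⟨_, ⟨h, rfl⟩, not_isDiag_of_mem_edgeSet _ (hc ⟨e, h⟩)⟩
  · intro i j u v hi hj
    obtain ⟨⟨h, rfl⟩, -⟩ := (fromEdgeSet_adj _).1 hi
    obtain ⟨⟨h', rfl⟩, -⟩ := (fromEdgeSet_adj _).1 hj
    rfl

theorem ForestCover.mono {V : Type*} {m : ℕ} {A B : Set (Sym2 V)} (h : ForestCover m B)
    (hAB : A ⊆ B) : ForestCover m A :=
  let ⟨F, hF, hB⟩ := h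
  ⟨F, hF, hAB.trans hB⟩

theorem ncard_iUnion_edgeSet {V : Type*} [Finite V] {m : ℕ} {F : Fin m → SimpleGraph V}
    (h : ∀ i j u v, (F i).Adj u v → (F j).Adj u v → i = j) :
    (⋃ i, (F i).edgeSet).ncard = ∑ i, (F i).edgeSet.ncard := by
  rw [Set.ncard_iUnion_of_finite (fun i => Set.toFinite _), finsum_eq_sum_of_fintype]
  intro i j hij
  refine Set.disjoint_left.2 fun e hi hj => hij ?_
  induction e with
  | _ u v => exact h i j u v hi hj

theorem isTreeConn_induce_iff {V : Type*} {m : ℕ} {G : SimpleGraph V} {X : Set V}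
    (hX : X.Nonempty) : IsTreeConn m (G.induce X) ↔ SpanConn m G X := by
  constructor
  · rintro ⟨T, hle, htree, hdisj⟩
    refine ⟨fun i => (T i).map (Function.Embedding.subtype _), fun i => ?_, fun i u v h => ?_,
      fun i j u v hi hj => ?_, fun i u hu v hv => ?_⟩
    · rw [map_le_iff_le_comap]
      exact hle i
    · obtain ⟨a, b, -, rfl, rfl⟩ := (map_adj _ _ _ _).1 h
      exact ⟨a.2, b.2⟩
    · by_contra hij
      obtain ⟨a, b, hab, rfl, rfl⟩ := (map_adj _ _ _ _).1 hi
      have hab' : (T j).Adj a b := (map_adj_apply (f := Function.Embedding.subtype _)).1 hj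
      exact Set.disjoint_left.1 (hdisj i j hij) (show s(a, b) ∈ (T i).edgeSet from hab) hab'
    · exact ((htree i).connected.preconnected ⟨u, hu⟩ ⟨v, hv⟩).map
        (Embedding.map (Function.Embedding.subtype _) (T i)).toHom
  · rintro ⟨T, hle, hin, hdisj, hconn⟩
    have : Nonempty X := hX.to_subtype
    have key : ∀ i, ((T i).induce X).Connected := by
      refine fun i => ⟨fun u v => ?_⟩
      have aux : ∀ {a b : V} (p : (T i).Walk a b) (ha : a ∈ X) (hb : b ∈ X),
          ((T i).induce X).Reachable ⟨a, ha⟩ ⟨b, hb⟩ := by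
        intro a b p
        induction p with
        | nil => exact fun _ _ => Reachable.refl _
        | cons h p ih =>
          intro ha hb
          have hc := (hin i _ _ h).2
          exact (show ((T i).induce X).Adj ⟨_, ha⟩ ⟨_, hc⟩ from h).reachable.trans (ih hc hb)
      obtain ⟨p⟩ := hconn i u u.2 v v.2
      exact aux p u.2 v.2
    choose S hS hStree using fun i => (key i).exists_isTree_le
    refine ⟨S, fun i u v h => hle i (hS i h), hStree, fun i j hij => ?_⟩
    refine Set.disjoint_left.2 fun e hi hj => hij ?_
    induction e with
    | _ u v => exact hdisj i j u v (hS i hi) (hS j hj)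

theorem SpanConn.union {V : Type*} {m : ℕ} {G : SimpleGraph V} {X Y : Set V} {w : V}
    (hX : SpanConn m G X) (hY : SpanConn m G Y) (hwX : w ∈ X) (hwY : w ∈ Y) :
    SpanConn m G (X ∪ Y) := by
  obtain ⟨T, hTle, hTin, hTd, hTc⟩ := hX
  obtain ⟨S, hSle, hSin, hSd, hSc⟩ := hY
  have hT : ∀ i, T i ≤ T i ⊔ S i \ insideGraph (S i) X := fun i => le_sup_left
  have hS : ∀ i, ∀ u ∈ Y, ∀ v ∈ Y, (T i ⊔ S i \ insideGraph (S i) X).Reachable u v := by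
    intro i u hu v hv
    refine reachable_of_adj_reachable (fun a b hab => ?_) (hSc i u hu v hv)
    by_cases h : a ∈ X ∧ b ∈ X
    · exact (hTc i a h.1 b h.2).mono (hT i)
    · exact Adj.reachable (Or.inr ⟨hab, fun h' => h h'.2⟩)
  refine ⟨fun i => T i ⊔ S i \ insideGraph (S i) X, fun i => ?_, fun i u v h => ?_,
    fun i j u v hi hj => ?_, fun i u hu v hv => ?_⟩
  · exact sup_le (hTle i) (sdiff_le.trans (hSle i))
  · rcases h with h | h
    · exact ⟨Or.inl (hTin i u v h).1, Or.inl (hTin i u v h).2⟩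
    · exact ⟨Or.inr (hSin i u v h.1).1, Or.inr (hSin i u v h.1).2⟩
  · rcases hi with hi | hi <;> rcases hj with hj | hj
    · exact hTd i j u v hi hj
    · exact absurd ⟨hj.1, hTin i u v hi⟩ hj.2
    · exact absurd ⟨hi.1, hTin j u v hj⟩ hi.2
    · exact hSd i j u v hi.1 hj.1
  · have aux : ∀ u ∈ X ∪ Y, (T i ⊔ S i \ insideGraph (S i) X).Reachable u w := by
      rintro u (hu | hu)
      · exact (hTc i u hu w hwX).mono (hT i)
      · exact hS i u hu w hwY
    exact (aux u hu).trans (aux v hv).symm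

theorem spanConn_singleton {V : Type*} (m : ℕ) (G : SimpleGraph V) (v : V) :
    SpanConn m G {v} :=
  ⟨fun _ => ⊥, fun _ => bot_le, fun _ _ _ h => h.elim, fun _ _ _ _ h => h.elim, by
    rintro i u rfl w rfl
    rfl⟩

section Components

variable {V : Type*} {m : ℕ} {G : SimpleGraph V}

theorem SpanConn.subset_mComp {X : Set V} {v : V} (hX : SpanConn m G X) (hv : v ∈ X) :
    X ⊆ mComp m G v :=
  Set.subset_sUnion_of_mem ⟨hv, (isTreeConn_induce_iff ⟨v, hv⟩).2 hX⟩

theorem mem_mComp_self (v : V) : v ∈ mComp m G v :=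
  (spanConn_singleton m G v).subset_mComp rfl rfl

variable [Finite V]

theorem spanConn_mComp (v : V) : SpanConn m G (mComp m G v) := by
  obtain ⟨X, hX⟩ := (Set.toFinite {X : Set V | v ∈ X ∧ SpanConn m G X}).exists_maximal
    ⟨{v}, rfl, spanConn_singleton m G v⟩
  have : mComp m G v = X := by
    refine subset_antisymm (Set.sUnion_subset ?_) (hX.prop.2.subset_mComp hX.prop.1)
    rintro Y ⟨hvY, hY⟩
    rw [isTreeConn_induce_iff ⟨v, hvY⟩] at hY
    exact Set.subset_union_right.trans
      (hX.le_of_ge ⟨Or.inl hX.prop.1, hX.prop.2.union hY hX.prop.1 hvY⟩ Set.subset_union_left)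
  rw [this]
  exact hX.prop.2

theorem mComp_eq_of_mem {u v : V} (h : u ∈ mComp m G v) : mComp m G u = mComp m G v := by
  have h1 : mComp m G v ⊆ mComp m G u := (spanConn_mComp v).subset_mComp h
  exact subset_antisymm ((spanConn_mComp u).subset_mComp (h1 (mem_mComp_self v))) h1

theorem SpanConn.mComp_eq {X : Set V} {u v : V} (hX : SpanConn m G X) (hu : u ∈ X) (hv : v ∈ X) :
    mComp m G u = mComp m G v :=
  mComp_eq_of_mem (hX.subset_mComp hv hu)

end Components

theorem SimpleGraph.IsAcyclic.ncard_edgeSet_add_card_connectedComponent {V : Type*} [Finite V]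
    {H : SimpleGraph V} (hH : H.IsAcyclic) :
    H.edgeSet.ncard + Nat.card H.ConnectedComponent = Nat.card V := by
  classical
  have := Fintype.ofFinite V
  have := Fintype.ofFinite H.ConnectedComponent
  have hV : Nat.card V = ∑ c : H.ConnectedComponent, Nat.card c := by
    rw [← Nat.card_sigma]
    exact Nat.card_congr (Equiv.sigmaFiberEquiv H.connectedComponentMk).symm
  have hE : H.edgeSet.ncard = ∑ c : H.ConnectedComponent, Nat.card c.toSimpleGraph.edgeSet := by
    rw [← Nat.card_sigma, ← Nat.card_coe_set_eq]
    symm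
    refine Nat.card_congr (Equiv.ofBijective
      (fun e => ⟨e.2.1.map Subtype.val, ?_⟩) ⟨?_, ?_⟩)
    · obtain ⟨c, e, he⟩ := e
      induction e with
      | _ u v => exact he
    · rintro ⟨c, e, he⟩ ⟨d, f, hf⟩ h
      simp only [Subtype.mk.injEq] at h
      obtain rfl : c = d := by
        induction e with
        | _ u v =>
          induction f with
          | _ a b =>
            have hu : (u : V) ∈ s((a : V), (b : V)) := by
              rw [Sym2.map_mk, Sym2.map_mk] at h
              rw [← h]
              simp
            rcases Sym2.mem_iff.1 hu with hu | hu
            · exact u.2.symm.trans (hu ▸ a.2)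
            · exact u.2.symm.trans (hu ▸ b.2)
      obtain rfl := Sym2.map.injective Subtype.val_injective h
      rfl
    · rintro ⟨e, he⟩
      induction e with
      | _ u v =>
        have huv : H.Adj u v := he
        exact ⟨⟨H.connectedComponentMk u, s(⟨u, rfl⟩,
          ⟨v, (ConnectedComponent.sound huv.reachable).symm⟩), huv⟩, rfl⟩
  have hc : ∀ c : H.ConnectedComponent, Nat.card c.toSimpleGraph.edgeSet + 1 = Nat.card c :=
    fun c => (isTree_iff_connected_and_card.1 (hH.isTree_connectedComponent c)).2
  rw [hV, hE, ← Finset.sum_congr rfl fun c _ => hc c, Finset.sum_add_distrib]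
  simp

theorem SimpleGraph.IsAcyclic.ncard_edgeSet_add_ncard_range_le {V α : Type*} [Finite V]
    {H : SimpleGraph V} (hH : H.IsAcyclic) (f : V → α) (hf : ∀ u v, H.Adj u v → f u = f v) :
    H.edgeSet.ncard + (Set.range f).ncard ≤ Nat.card V := by
  rw [← hH.ncard_edgeSet_add_card_connectedComponent, ← Nat.card_coe_set_eq (Set.range f)]
  gcongr
  refine Nat.card_le_card_of_surjective
    (ConnectedComponent.lift (fun v => (⟨f v, v, rfl⟩ : Set.range f))
      fun u v p _ => Subtype.ext (apply_eq_of_reachable hf p.reachable)) ?_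
  rintro ⟨_, v, rfl⟩
  exact ⟨H.connectedComponentMk v, rfl⟩

theorem SimpleGraph.IsAcyclic.ncard_edgeSet_add_ncard_range_eq {V α : Type*} [Finite V]
    {H : SimpleGraph V} (hH : H.IsAcyclic) (f : V → α) (hf : ∀ u v, H.Reachable u v ↔ f u = f v) :
    H.edgeSet.ncard + (Set.range f).ncard = Nat.card V := by
  refine le_antisymm
    (hH.ncard_edgeSet_add_ncard_range_le f fun u v h => (hf u v).1 h.reachable) ?_
  rw [← hH.ncard_edgeSet_add_card_connectedComponent, ← Nat.card_coe_set_eq (Set.range f)]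
  gcongr
  refine Nat.card_le_card_of_surjective
    (fun a : Set.range f => H.connectedComponentMk a.2.choose) fun c => ?_
  induction c using ConnectedComponent.ind with
  | _ v =>
    refine ⟨⟨f v, v, rfl⟩, ConnectedComponent.sound ((hf _ _).2 ?_)⟩
    exact (⟨v, rfl⟩ : ∃ w, f w = f v).choose_spec

theorem SimpleGraph.IsAcyclic.ncard_edgeSet_add_one_le {V : Type*} [Finite V] [Nonempty V]
    {H : SimpleGraph V} (hH : H.IsAcyclic) : H.edgeSet.ncard + 1 ≤ Nat.card V := by
  simpa using hH.ncard_edgeSet_add_ncard_range_le (fun _ => ()) fun _ _ _ => rfl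

section Rank

variable {V : Type*} {m : ℕ} {G : SimpleGraph V}

/-- The edges of `G` joining different components. -/
def crossSet (m : ℕ) (G : SimpleGraph V) : Set (Sym2 V) :=
  {e ∈ G.edgeSet | ∃ u ∈ e, ∃ w ∈ e, mComp m G u ≠ mComp m G w}

theorem mk_mem_crossSet {u v : V} :
    s(u, v) ∈ crossSet m G ↔ G.Adj u v ∧ mComp m G u ≠ mComp m G v := by
  simp only [crossSet, Set.mem_ofPred_eq, mem_edgeSet, Sym2.mem_iff]
  constructor
  · rintro ⟨h, a, rfl | rfl, b, rfl | rfl, hab⟩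
    exacts [absurd rfl hab, ⟨h, hab⟩, ⟨h, hab.symm⟩, absurd rfl hab]
  · exact fun ⟨h, hab⟩ => ⟨h, u, Or.inl rfl, v, Or.inr rfl, hab⟩

variable [Finite V]

theorem ForestCover.ncard_add_omega_le {A : Set (Sym2 V)} (hA : ForestCover m A)
    (hAG : A ⊆ G.edgeSet) : (A.ncard : ℤ) + Omega m G ≤ m * Nat.card V := by
  obtain ⟨F, hF, rfl, -⟩ := hA.exists_partition
  have hsub : (⋃ i, (F i).edgeSet) ⊆
      crossSet m G ∪ ⋃ i, ((F i).deleteEdges (crossSet m G)).edgeSet := by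
    intro e he
    obtain ⟨i, hi⟩ := Set.mem_iUnion.1 he
    by_cases hc : e ∈ crossSet m G
    · exact Or.inl hc
    · exact Or.inr (Set.mem_iUnion.2 ⟨i, by simp [hi, hc]⟩)
  have h1 := (Set.ncard_le_ncard hsub (Set.toFinite _)).trans (Set.ncard_union_le _ _)
  have h2 := Set.ncard_iUnion_le_of_fintype
    fun i => ((F i).deleteEdges (crossSet m G)).edgeSet
  have h3 : ∑ i, (((F i).deleteEdges (crossSet m G)).edgeSet.ncard +
      (Set.range (mComp m G)).ncard) ≤ ∑ _i : Fin m, Nat.card V := by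
    refine Finset.sum_le_sum fun i _ => ?_
    refine ((hF i).anti (deleteEdges_le _)).ncard_edgeSet_add_ncard_range_le _ ?_
    intro u v huv
    rw [deleteEdges_adj, mk_mem_crossSet] at huv
    by_contra hne
    have hG : s(u, v) ∈ G.edgeSet := hAG (Set.mem_iUnion.2 ⟨i, huv.1⟩)
    exact huv.2 ⟨hG, hne⟩
  rw [Finset.sum_add_distrib] at h3
  simp only [Finset.sum_const, Finset.card_univ, Fintype.card_fin, smul_eq_mul] at h3
  have h4 : crossE m G = (crossSet m G).ncard := rfl
  rw [Omega, h4]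
  zify at h1 h2 h3
  linarith

/-- There are edge-disjoint spanning forests of `G` whose trees span the components. -/
theorem exists_forests_spanning_mComp (m : ℕ) (G : SimpleGraph V) :
    ∃ H : Fin m → SimpleGraph V, (∀ i, H i ≤ G) ∧ (∀ i, (H i).IsAcyclic) ∧
      (∀ i j u v, (H i).Adj u v → (H j).Adj u v → i = j) ∧
      ∀ i u v, (H i).Reachable u v ↔ mComp m G u = mComp m G v := by
  choose T hle hin hdisj hconn using
    fun C : Set.range (mComp m G) => show SpanConn m G C.1 by
      obtain ⟨_, v, rfl⟩ := C
      exact spanConn_mComp v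
  let K : Fin m → SimpleGraph V := fun i => ⨆ C, T C i
  have hKadj : ∀ {i u v}, (K i).Adj u v ↔ ∃ C, (T C i).Adj u v := by
    intro i u v
    simp [K]
  have hmem : ∀ (C : Set.range (mComp m G)) {u}, u ∈ C.1 → mComp m G u = C.1 := by
    rintro ⟨_, v, rfl⟩ u hu
    exact mComp_eq_of_mem hu
  have hK : ∀ i u v, (K i).Reachable u v ↔ mComp m G u = mComp m G v := by
    refine fun i u v => ⟨apply_eq_of_reachable fun a b hab => ?_, fun h => ?_⟩
    · obtain ⟨C, hC⟩ := hKadj.1 hab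
      rw [hmem C (hin C i a b hC).1, hmem C (hin C i a b hC).2]
    · exact (hconn ⟨mComp m G u, u, rfl⟩ i u (mem_mComp_self u) v
        (h.symm.subset (mem_mComp_self v))).mono (le_iSup (fun C => T C i) _)
  choose H hHle hHac hHr using fun i => (K i).exists_isAcyclic_reachable_eq_le
  refine ⟨H, fun i => (hHle i).trans (iSup_le fun C => hle C i), hHac, ?_, fun i u v => ?_⟩
  · intro i j u v hi hj
    obtain ⟨C, hC⟩ := hKadj.1 (hHle i hi)
    obtain ⟨D, hD⟩ := hKadj.1 (hHle j hj)
    obtain rfl : C = D := Subtype.ext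
      ((hmem C (hin C i u v hC).1).symm.trans (hmem D (hin D j u v hD).1))
    exact hdisj C i j u v hC hD
  · rw [hHr i, hK]

theorem ForestCover.union_of_subset_crossSet {A D : Set (Sym2 V)} (hA : ForestCover m A)
    (hAG : A ⊆ G.edgeSet) (hD : D ⊆ crossSet m G) : ForestCover m (A ∪ D) := by
  induction D, Set.toFinite D using Set.Finite.induction_on with
  | empty => simpa using hA
  | @insert e D _ _ ih =>
    have hDc : D ⊆ crossSet m G := (Set.subset_insert _ _).trans hD
    obtain ⟨F, hF, hFA, hdisj⟩ := (ih hDc).exists_partition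
    have he : e ∈ crossSet m G := hD (Set.mem_insert _ _)
    rw [Set.union_insert, ← hFA]
    by_contra hcov
    induction e with
    | _ x y =>
      rw [mk_mem_crossSet] at he
      obtain ⟨U, hx, hy, hU⟩ := exists_connected_of_not_forestCover hF he.1.ne hcov
      refine he.2 (SpanConn.mComp_eq (X := U) ⟨fun i => insideGraph (F i) U, ?_,
        fun i u v h => h.2, fun i j u v hi hj => hdisj i j u v hi.1 hj.1, hU⟩ hx hy)
      intro i u v h
      have : s(u, v) ∈ A ∪ D := hFA ▸ Set.mem_iUnion.2 ⟨i, h.1⟩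
      exact this.elim (fun h => hAG h) fun h => (hDc h).1

/-- The maximum size of a union of `m` forests of `G` is at least `m |V| - Ω_m(G)`. -/
theorem exists_forestCover_ncard_add_omega (m : ℕ) (G : SimpleGraph V) :
    ∃ A ⊆ G.edgeSet, ForestCover m A ∧ (A.ncard : ℤ) + Omega m G = m * Nat.card V := by
  obtain ⟨H, hle, hac, hdisj, hr⟩ := exists_forests_spanning_mComp m G
  have hHG : (⋃ i, (H i).edgeSet) ⊆ G.edgeSet :=
    Set.iUnion_subset fun i => edgeSet_mono (hle i)
  refine ⟨(⋃ i, (H i).edgeSet) ∪ crossSet m G, Set.union_subset hHG fun e he => he.1,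
    ForestCover.union_of_subset_crossSet ⟨H, hac, subset_rfl⟩ hHG subset_rfl, ?_⟩
  rw [Set.ncard_union_eq, ncard_iUnion_edgeSet hdisj]
  · have h3 : ∑ i, ((H i).edgeSet.ncard + (Set.range (mComp m G)).ncard) =
        ∑ _i : Fin m, Nat.card V :=
      Finset.sum_congr rfl fun i _ =>
        (hac i).ncard_edgeSet_add_ncard_range_eq _ (hr i)
    rw [Finset.sum_add_distrib] at h3
    simp only [Finset.sum_const, Finset.card_univ, Fintype.card_fin, smul_eq_mul] at h3
    have h4 : crossE m G = (crossSet m G).ncard := rfl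
    rw [Omega, h4]
    zify at h3
    push_cast
    linarith
  · refine Set.disjoint_left.2 fun e he hc => ?_
    obtain ⟨i, hi⟩ := Set.mem_iUnion.1 he
    induction e with
    | _ u v => exact (mk_mem_crossSet.1 hc).2 ((hr i u v).1 (Adj.reachable hi))

theorem le_omega [Nonempty V] (m : ℕ) (G : SimpleGraph V) : (m : ℤ) ≤ Omega m G := by
  obtain ⟨A, -, ⟨F, hF, hA⟩, hcard⟩ := exists_forestCover_ncard_add_omega m G
  have h1 := (Set.ncard_le_ncard hA (Set.toFinite _)).trans (Set.ncard_iUnion_le_of_fintype _)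
  have h2 : ∑ i, ((F i).edgeSet.ncard + 1) ≤ ∑ _i : Fin m, Nat.card V :=
    Finset.sum_le_sum fun i _ => (hF i).ncard_edgeSet_add_one_le
  rw [Finset.sum_add_distrib] at h2
  simp only [Finset.sum_const, Finset.card_univ, Fintype.card_fin, smul_eq_mul, mul_one] at h2
  zify at h1 h2
  linarith

theorem omega_anti {G' : SimpleGraph V} (h : G' ≤ G) : Omega m G ≤ Omega m G' := by
  obtain ⟨A, hAG, hA, hcard⟩ := exists_forestCover_ncard_add_omega m G'
  have := hA.ncard_add_omega_le (hAG.trans (edgeSet_mono h))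
  linarith

theorem omega_deleteEdges_singleton_le (m : ℕ) (G : SimpleGraph V) (e : Sym2 V) :
    Omega m (G.deleteEdges {e}) ≤ Omega m G + 1 := by
  obtain ⟨A, hAG, hA, hcard⟩ := exists_forestCover_ncard_add_omega m G
  have h1 := (hA.mono (Set.sdiff_subset (t := {e}))).ncard_add_omega_le
    (G := G.deleteEdges {e}) (by
      rw [edgeSet_deleteEdges]
      exact Set.sdiff_subset_sdiff_left hAG)
  have h2 : A.ncard ≤ (A \ {e}).ncard + 1 := by
    simpa using Set.ncard_le_ncard_sdiff_add_ncard A {e}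
  zify at h2
  linarith

theorem omega_eq_iff_isTreeConn [Nonempty V] (m : ℕ) (G : SimpleGraph V) :
    Omega m G = m ↔ IsTreeConn m G := by
  constructor
  · intro hΩ
    obtain ⟨A, hAG, hA, hcard⟩ := exists_forestCover_ncard_add_omega m G
    obtain ⟨F, hF, rfl, hdisj⟩ := hA.exists_partition
    have hle : ∀ i, (F i).edgeSet.ncard + 1 ≤ Nat.card V :=
      fun i => (hF i).ncard_edgeSet_add_one_le
    have hsum : ∑ i, ((F i).edgeSet.ncard + 1) = ∑ _i : Fin m, Nat.card V := by
      rw [hΩ, ncard_iUnion_edgeSet hdisj] at hcard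
      rw [Finset.sum_add_distrib]
      simp only [Finset.sum_const, Finset.card_univ, Fintype.card_fin, smul_eq_mul, mul_one]
      exact_mod_cast hcard
    refine ⟨F, fun i => ?_, fun i => ?_, fun i j hij => ?_⟩
    · exact edgeSet_subset_edgeSet.1 ((Set.subset_iUnion (fun i => (F i).edgeSet) i).trans hAG)
    · have hi := (Finset.sum_eq_sum_iff_of_le fun i _ => hle i).1 hsum i (Finset.mem_univ i)
      have hcc := (hF i).ncard_edgeSet_add_card_connectedComponent
      have : Nat.card (F i).ConnectedComponent = 1 := by omega
      obtain ⟨hsub, -⟩ := Nat.card_eq_one_iff_unique.1 this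
      exact ⟨⟨fun u v => ConnectedComponent.exact (hsub.elim _ _)⟩, hF i⟩
    · refine Set.disjoint_left.2 fun e hi hj => hij ?_
      induction e with
      | _ u v => exact hdisj i j u v hi hj
  · rintro ⟨T, hle, htree, hdisj⟩
    refine le_antisymm ?_ (le_omega m G)
    have hcover : ForestCover m (⋃ i, (T i).edgeSet) :=
      ⟨T, fun i => (htree i).isAcyclic, subset_rfl⟩
    have h1 := hcover.ncard_add_omega_le
      (Set.iUnion_subset fun i => edgeSet_mono (hle i))
    rw [ncard_iUnion_edgeSet fun i j u v hi hj => by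
      by_contra hij
      exact Set.disjoint_left.1 (hdisj i j hij) (show s(u, v) ∈ (T i).edgeSet from hi) hj] at h1
    have h2 : ∑ i, ((T i).edgeSet.ncard + 1) = ∑ _i : Fin m, Nat.card V :=
      Finset.sum_congr rfl fun i _ => (isTree_iff_connected_and_card.1 (htree i)).2
    rw [Finset.sum_add_distrib] at h2
    simp only [Finset.sum_const, Finset.card_univ, Fintype.card_fin, smul_eq_mul, mul_one] at h2
    zify at h2
    push_cast at h1
    linarith

end Rank

theorem stmt12 {V : Type*} [Fintype V] [Nonempty V] (m : ℕ) (hm : 0 < m)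
    (G : SimpleGraph V) (e : Sym2 V) (he : e ∈ G.edgeSet) :
    ((m : ℤ) ≤ Omega m G ∧ Omega m G ≤ Omega m (G.deleteEdges {e}) ∧
      Omega m (G.deleteEdges {e}) ≤ Omega m G + 1) ∧
    (Omega m G = m ↔ IsTreeConn m G) := by
  exact ⟨⟨le_omega m G, omega_anti (deleteEdges_le _), omega_deleteEdges_singleton_le m G e⟩,
    omega_eq_iff_isTreeConn m G⟩
end

section
/- For every graph G and every positive integer m, (1/m)·Ω_m(G) ≤ (1/(m+1))·Ω_{m+1}(G). In particular, ω(G) = Ω_1(G) ≤ (1/2)Ω_2(G) ≤ (1/3)Ω_3(G) ≤ ⋯ ≤ |V(G)|. -/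
open SimpleGraph

namespace TreePacking

section Components

variable {V ι : Type*} {H H' : SimpleGraph V}

lemma eq_of_reachable {p : V → ι} (h : ∀ u v, H.Adj u v → p u = p v) {u v : V}
    (huv : H.Reachable u v) : p u = p v := by
  obtain ⟨w⟩ := huv
  induction w with
  | nil => rfl
  | cons h' _ ih => exact (h _ _ h').trans ih

lemma reachable_of_adj_reachable (h : ∀ u v, H.Adj u v → H'.Reachable u v) {u v : V}
    (huv : H.Reachable u v) : H'.Reachable u v :=
  ConnectedComponent.exact <|
    eq_of_reachable (p := H'.connectedComponentMk)
      (fun a b hab => ConnectedComponent.sound (h a b hab)) huv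

/-- The number of connected components. -/
noncomputable def numComp (H : SimpleGraph V) : ℕ := Nat.card H.ConnectedComponent

variable [Finite V]

lemma numComp_le_ncard_range {p : V → ι} (h : ∀ u v, p u = p v → H.Reachable u v) :
    numComp H ≤ (Set.range p).ncard := by
  rw [← Nat.card_coe_set_eq]
  refine Nat.card_le_card_of_injective
    (fun C : H.ConnectedComponent => (⟨p C.out, Set.mem_range_self _⟩ : Set.range p)) ?_
  intro C D hCD
  have := ConnectedComponent.sound (h _ _ (Subtype.ext_iff.1 hCD))
  rwa [← C.out_eq, ← D.out_eq]

lemma ncard_range_le_numComp {p : V → ι} (h : ∀ u v, H.Adj u v → p u = p v) :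
    (Set.range p).ncard ≤ numComp H := by
  rw [← Nat.card_coe_set_eq]
  refine Nat.card_le_card_of_injective
    (fun x : Set.range p => H.connectedComponentMk x.2.choose) ?_
  intro x y hxy
  have := eq_of_reachable h (ConnectedComponent.exact hxy)
  rw [x.2.choose_spec, y.2.choose_spec] at this
  exact Subtype.ext this

lemma numComp_deleteEdges_le (e : Sym2 V) : numComp (H.deleteEdges {e}) ≤ numComp H + 1 := by
  classical
  induction e with | h u v
  rw [numComp, numComp, ← Finite.card_option]
  set K := H.deleteEdges {s(u, v)} with hK
  set c := K.connectedComponentMk with hc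
  have hq : ∀ a b, H.Adj a b →
      (if c a = c v then c u else c a) = (if c b = c v then c u else c b) := by
    intro a b hab
    by_cases he : s(a, b) = s(u, v)
    · rw [Sym2.eq_iff] at he
      obtain ⟨rfl, rfl⟩ | ⟨rfl, rfl⟩ := he <;> simp
    · have : c a = c b := ConnectedComponent.sound (Adj.reachable (by simp [hK, hab, he]))
      rw [this]
  refine Nat.card_le_card_of_injective (fun C : K.ConnectedComponent =>
    if C = c u then none else some (H.connectedComponentMk C.out)) ?_
  intro C D hCD
  have hC : c C.out = C := C.out_eq
  have hD : c D.out = D := D.out_eq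
  dsimp only at hCD
  by_cases h1 : C = c u <;> by_cases h2 : D = c u <;> simp only [h1, h2, if_true, if_false] at hCD ⊢
  · simp at hCD
  · simp at hCD
  · have := eq_of_reachable hq (ConnectedComponent.exact (Option.some.inj hCD))
    rw [hC, hD] at this
    grind

lemma numComp_lt_deleteEdges {e : Sym2 V} (he : e ∈ H.edgeSet) (hb : H.IsBridge e) :
    numComp H + 1 ≤ numComp (H.deleteEdges {e}) := by
  classical
  induction e with | h u v
  rw [isBridge_iff] at hb
  rw [numComp, numComp, ← Finite.card_option]
  set K := H.deleteEdges {s(u, v)} with hK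
  have hle : K ≤ H := deleteEdges_le _
  refine Nat.card_le_card_of_surjective (fun C : K.ConnectedComponent =>
    if C = K.connectedComponentMk u then none else some (C.map (Hom.ofLE hle))) ?_
  rintro (_ | D)
  · exact ⟨K.connectedComponentMk u, by simp⟩
  · induction D using ConnectedComponent.ind with | h w
    by_cases hw : K.connectedComponentMk w = K.connectedComponentMk u
    · refine ⟨K.connectedComponentMk v, ?_⟩
      have hvu : K.connectedComponentMk v ≠ K.connectedComponentMk u :=
        fun h => hb (ConnectedComponent.exact h).symm
      beta_reduce
      rw [if_neg hvu]
      refine congrArg some (ConnectedComponent.sound ?_)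
      exact (Adj.reachable (by simpa using he) : H.Reachable u v).symm.trans
        ((ConnectedComponent.exact hw).mono hle).symm
    · exact ⟨K.connectedComponentMk w, by beta_reduce; rw [if_neg hw]; rfl⟩

lemma ncard_edgeSet_sdiff_deleteEdges {e : Sym2 V} (he : e ∈ H.edgeSet) (he' : e ∉ H'.edgeSet) :
    ((H.deleteEdges {e}).edgeSet \ H'.edgeSet).ncard + 1 = (H.edgeSet \ H'.edgeSet).ncard := by
  rw [edgeSet_deleteEdges, Set.sdiff_sdiff_comm]
  exact Set.ncard_sdiff_singleton_add_one ⟨he, he'⟩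

/-- Induction from a subgraph to a supergraph, one edge at a time. -/
lemma induction_deleteEdges {P : SimpleGraph V → Prop} (hle : H' ≤ H) (base : P H')
    (step : ∀ K ≤ H, ∀ e ∈ K.edgeSet, e ∉ H'.edgeSet → H' ≤ K → P (K.deleteEdges {e}) → P K) :
    P H := by
  suffices ∀ n, ∀ K ≤ H, H' ≤ K → (K.edgeSet \ H'.edgeSet).ncard = n → P K from
    this _ H le_rfl hle rfl
  intro n
  induction n with
  | zero =>
    intro K _ hK hn
    rw [Set.ncard_eq_zero, Set.sdiff_eq_empty, edgeSet_subset_edgeSet] at hn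
    rwa [le_antisymm hn hK]
  | succ n ih =>
    intro K hKH hK hn
    obtain ⟨e, heK, heH⟩ : (K.edgeSet \ H'.edgeSet).Nonempty :=
      (Set.ncard_pos (Set.toFinite _)).1 (by omega)
    refine step K hKH e heK heH hK (ih _ ((deleteEdges_le _).trans hKH) ?_ ?_)
    · rw [← edgeSet_subset_edgeSet, edgeSet_deleteEdges]
      exact fun f hf => ⟨edgeSet_mono hK hf, fun h => heH (h ▸ hf)⟩
    · have := ncard_edgeSet_sdiff_deleteEdges heK heH
      omega

lemma numComp_le_add_ncard (hle : H' ≤ H) :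
    numComp H' ≤ numComp H + (H.edgeSet \ H'.edgeSet).ncard := by
  refine induction_deleteEdges
    (P := fun K => numComp H' ≤ numComp K + (K.edgeSet \ H'.edgeSet).ncard) hle (by simp)
    fun K _ e he he' _ ih => ?_
  have := numComp_deleteEdges_le (H := K) e
  have := ncard_edgeSet_sdiff_deleteEdges he he'
  omega

lemma numComp_add_ncard_le (hle : H' ≤ H) (hH : H.IsAcyclic) :
    numComp H + (H.edgeSet \ H'.edgeSet).ncard ≤ numComp H' := by
  refine induction_deleteEdges
    (P := fun K => numComp K + (K.edgeSet \ H'.edgeSet).ncard ≤ numComp H') hle (by simp)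
    fun K hK e he he' _ ih => ?_
  have := numComp_lt_deleteEdges he (isAcyclic_iff_forall_isBridge.1 (hH.anti hK) he)
  have := ncard_edgeSet_sdiff_deleteEdges he he'
  omega

end Components

section Exchange

variable {V : Type*} {k : ℕ}

lemma not_reachable_deleteEdges_of_mem_path {F : SimpleGraph V} (hF : F.IsAcyclic) {x y : V}
    {p : F.Walk x y} (hp : p.IsPath) {d : Sym2 V} (hd : d ∈ p.edges) :
    ¬ (F.deleteEdges {d}).Reachable x y := by
  classical
  induction d with | h a b
  rw [reachable_deleteEdges_iff_exists_walk]
  rintro ⟨q, hq⟩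
  have := (hF.subsingleton_path x y).elim ⟨p, hp⟩ q.toPath
  have hpq : p = q.bypass := congrArg Subtype.val this
  rw [hpq] at hd
  exact hq (q.edges_bypass_subset_edges hd)

/-- The graph formed by the edges of color `i` in a partial edge coloring. -/
def colorClass (c : Sym2 V → Option (Fin k)) (i : Fin k) : SimpleGraph V :=
  fromEdgeSet {e | c e = some i}

/-- A partial edge coloring of `G` all of whose color classes are forests. -/
structure IsForestColoring (G : SimpleGraph V) (c : Sym2 V → Option (Fin k)) : Prop where
  mem_edgeSet : ∀ e, c e ≠ none → e ∈ G.edgeSet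
  isAcyclic : ∀ i, (colorClass c i).IsAcyclic

open Classical in
/-- `Exchange G c₀ c e` says that the coloring `c`, in which `e` is uncolored, is obtained from `c₀`
by repeatedly coloring an uncolored edge and uncoloring an edge of its fundamental cycle. -/
inductive Exchange (G : SimpleGraph V) (c₀ : Sym2 V → Option (Fin k)) :
    (Sym2 V → Option (Fin k)) → Sym2 V → Prop
  | base (e : Sym2 V) (he : e ∈ G.edgeSet) (h : c₀ e = none) : Exchange G c₀ c₀ e
  | step (c : Sym2 V → Option (Fin k)) (x y : V) (i : Fin k) (d : Sym2 V)
      (h : Exchange G c₀ c s(x, y)) (hd : c d = some i)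
      (hr : ¬ (colorClass (Function.update c d none) i).Reachable x y) :
      Exchange G c₀ (Function.update (Function.update c d none) s(x, y) (some i)) d

/-- The edges that become uncolored after some sequence of exchanges. -/
def exchangeable (G : SimpleGraph V) (c₀ : Sym2 V → Option (Fin k)) : Set (Sym2 V) :=
  {e | ∃ c, Exchange G c₀ c e}

/-- The edges of color `i` among the exchangeable ones. -/
def restrictedClass (G : SimpleGraph V) (c₀ c : Sym2 V → Option (Fin k)) (i : Fin k) :
    SimpleGraph V :=
  fromEdgeSet {e | c e = some i ∧ e ∈ exchangeable G c₀}

variable {G : SimpleGraph V} {c₀ c : Sym2 V → Option (Fin k)}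

lemma mem_edgeSet_colorClass (hc : IsForestColoring G c) {e : Sym2 V} {i : Fin k} :
    e ∈ (colorClass c i).edgeSet ↔ c e = some i := by
  rw [colorClass, edgeSet_fromEdgeSet]
  refine ⟨fun h => h.1, fun h => ⟨h, fun hd => ?_⟩⟩
  exact G.not_isDiag_of_mem_edgeSet (hc.mem_edgeSet e (by simp [h])) hd

lemma colorClass_update_none_le [DecidableEq (Sym2 V)] (d : Sym2 V) (i : Fin k) :
    colorClass (Function.update c d none) i ≤ (colorClass c i).deleteEdges {d} := by
  intro u v h
  simp only [colorClass, fromEdgeSet_adj, Set.mem_ofPred_eq, deleteEdges_adj] at h ⊢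
  grind

lemma IsForestColoring.update_none [DecidableEq (Sym2 V)] (hc : IsForestColoring G c)
    (d : Sym2 V) : IsForestColoring G (Function.update c d none) where
  mem_edgeSet e he := hc.mem_edgeSet e (by grind)
  isAcyclic i := (hc.isAcyclic i).anti ((colorClass_update_none_le d i).trans (deleteEdges_le _))

lemma IsForestColoring.update_some [DecidableEq (Sym2 V)] (hc : IsForestColoring G c) {x y : V}
    {i : Fin k} (he : s(x, y) ∈ G.edgeSet) (hr : ¬ (colorClass c i).Reachable x y) :
    IsForestColoring G (Function.update c s(x, y) (some i)) where
  mem_edgeSet e h := by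
    by_cases hxy : e = s(x, y)
    · rwa [hxy]
    · exact hc.mem_edgeSet e (by rwa [Function.update_of_ne hxy] at h)
  isAcyclic j := by
    refine IsAcyclic.anti (G' := if j = i then colorClass c i ⊔ edge x y else colorClass c j) ?_ ?_
    · intro u v h
      split_ifs with hj <;>
      simp only [colorClass, fromEdgeSet_adj, Set.mem_ofPred_eq, sup_adj, adj_edge] at h ⊢ <;>
      grind
    · split_ifs
      · exact (hc.isAcyclic i).sup_edge_of_not_reachable hr
      · exact hc.isAcyclic j

variable [Finite V]

lemma ncard_colored_update_some [DecidableEq (Sym2 V)] {e : Sym2 V} (he : c e = none) (i : Fin k) :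
    {f | Function.update c e (some i) f ≠ none}.ncard = {f | c f ≠ none}.ncard + 1 := by
  rw [← Set.ncard_insert_of_notMem (a := e) (by simpa using he)]
  congr 1
  ext f
  simp only [Set.mem_ofPred_eq, Set.mem_insert_iff]
  grind

lemma ncard_colored_update_none [DecidableEq (Sym2 V)] {e : Sym2 V} (he : c e ≠ none) :
    {f | Function.update c e none f ≠ none}.ncard + 1 = {f | c f ≠ none}.ncard := by
  rw [← Set.ncard_sdiff_singleton_add_one (a := e) (s := {f | c f ≠ none}) he]
  congr 2
  ext f
  simp only [Set.mem_ofPred_eq, Set.mem_sdiff, Set.mem_singleton_iff]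
  grind

lemma Exchange.invariants (hc₀ : IsForestColoring G c₀) {e : Sym2 V} (h : Exchange G c₀ c e) :
    IsForestColoring G c ∧ e ∈ G.edgeSet ∧ c e = none ∧
      {f | c f ≠ none}.ncard = {f | c₀ f ≠ none}.ncard := by
  classical
  induction h with
  | base e he h => exact ⟨hc₀, he, h, rfl⟩
  | step c x y i d h hd hr ih =>
    obtain ⟨h1, h2, h3, h4⟩ := ih
    have hd' : c d ≠ none := by simp [hd]
    have hne : d ≠ s(x, y) := by rintro rfl; exact hd' h3
    refine ⟨(h1.update_none d).update_some h2 hr, h1.mem_edgeSet d hd', by simp [hne], ?_⟩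
    rw [ncard_colored_update_some (by grind), ncard_colored_update_none hd', h4]

variable (hc₀ : IsForestColoring G c₀)
  (hmax : ∀ c : Sym2 V → Option (Fin k), IsForestColoring G c →
    {f | c f ≠ none}.ncard ≤ {f | c₀ f ≠ none}.ncard)

include hc₀ hmax

lemma Exchange.reachable_restrictedClass {x y : V} (h : Exchange G c₀ c s(x, y)) (i : Fin k) :
    (restrictedClass G c₀ c i).Reachable x y := by
  classical
  obtain ⟨hc, he, hn, hcard⟩ := h.invariants hc₀
  by_cases hr : (colorClass c i).Reachable x y
  · obtain ⟨p, hp⟩ := hr.exists_isPath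
    refine ⟨p.transfer _ fun d hd => ?_⟩
    have hdF := p.edges_subset_edgeSet hd
    have hdc := (mem_edgeSet_colorClass hc).1 hdF
    rw [restrictedClass, edgeSet_fromEdgeSet]
    refine ⟨⟨hdc, _, Exchange.step c x y i d h hdc fun hr' => ?_⟩, ?_⟩
    · exact not_reachable_deleteEdges_of_mem_path (hc.isAcyclic i) hp hd
        (hr'.mono (colorClass_update_none_le d i))
    · exact not_isDiag_of_mem_edgeSet _ hdF
  · have := hmax _ (hc.update_some he hr)
    rw [ncard_colored_update_some hn] at this
    omega

lemma Exchange.reachable_restrictedClass_mono {e : Sym2 V} (h : Exchange G c₀ c e) (i : Fin k)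
    {u v : V} (huv : (restrictedClass G c₀ c i).Reachable u v) :
    (restrictedClass G c₀ c₀ i).Reachable u v := by
  classical
  induction h generalizing u v with
  | base => exact huv
  | step c x y j d h hd hr ih =>
    refine ih (reachable_of_adj_reachable (fun a b hab => ?_) huv)
    have hxy := h.reachable_restrictedClass hc₀ hmax i
    by_cases hs : s(a, b) = s(x, y)
    · rw [Sym2.eq_iff] at hs
      obtain ⟨rfl, rfl⟩ | ⟨rfl, rfl⟩ := hs
      · exact hxy
      · exact hxy.symm
    · refine Adj.reachable ?_
      simp only [restrictedClass, fromEdgeSet_adj, Set.mem_ofPred_eq] at hab ⊢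
      refine ⟨⟨?_, hab.1.2⟩, hab.2⟩
      have := hab.1.1
      grind

lemma reachable_restrictedClass_of_mem_exchangeable {x y : V}
    (h : s(x, y) ∈ exchangeable G c₀) (i : Fin k) :
    (restrictedClass G c₀ c₀ i).Reachable x y := by
  obtain ⟨c, hc⟩ := h
  exact hc.reachable_restrictedClass_mono hc₀ hmax i (hc.reachable_restrictedClass hc₀ hmax i)

omit hc₀ hmax in
/-- There are `k` edge-disjoint forests `F i` in `G` and a graph `R` such that every edge of `G`
outside `R` lies in some `F i`, and each `F i` contains a spanning forest of `R`. -/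
lemma exists_forests (k : ℕ) (G : SimpleGraph V) :
    ∃ (F T : Fin k → SimpleGraph V) (R : SimpleGraph V),
      (∀ i, F i ≤ G) ∧ (∀ i, (F i).IsAcyclic) ∧
      (∀ i j, i ≠ j → ∀ u v, (F i).Adj u v → ¬ (F j).Adj u v) ∧
      (∀ i, T i ≤ F i) ∧ (∀ i, T i ≤ R) ∧
      (∀ i u v, R.Adj u v → (T i).Reachable u v) ∧
      ∀ e ∈ G.edgeSet, e ∈ R.edgeSet ∨ ∃ i, e ∈ (F i).edgeSet := by
  have : Nonempty {c : Sym2 V → Option (Fin k) // IsForestColoring G c} := by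
    refine ⟨fun _ => none, by simp, fun i => ?_⟩
    convert isAcyclic_bot
    ext; simp [colorClass]
  obtain ⟨⟨c₀, hc₀⟩, hmax⟩ := Finite.exists_max
    (fun c : {c : Sym2 V → Option (Fin k) // IsForestColoring G c} => {f | c.1 f ≠ none}.ncard)
  replace hmax := fun c hc => hmax ⟨c, hc⟩
  dsimp only at hmax
  refine ⟨colorClass c₀, restrictedClass G c₀ c₀, fromEdgeSet (exchangeable G c₀),
    fun i u v h => ?_, hc₀.isAcyclic, fun i j hij u v h h' => ?_, fun i u v h => ?_,
    fun i u v h => ?_, fun i u v h => ?_, fun e he => ?_⟩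
  · exact hc₀.mem_edgeSet s(u, v) (by simp [((fromEdgeSet_adj _).1 h).1.out])
  · have h1 : c₀ s(u, v) = some i := ((fromEdgeSet_adj _).1 h).1
    have h2 : c₀ s(u, v) = some j := ((fromEdgeSet_adj _).1 h').1
    grind
  · simp only [restrictedClass, colorClass, fromEdgeSet_adj, Set.mem_ofPred_eq] at h ⊢
    exact ⟨h.1.1, h.2⟩
  · simp only [restrictedClass, fromEdgeSet_adj, Set.mem_ofPred_eq] at h ⊢
    exact ⟨h.1.2, h.2⟩
  · exact reachable_restrictedClass_of_mem_exchangeable hc₀ hmax ((fromEdgeSet_adj _).1 h).1 i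
  · cases hce : c₀ e with
    | none =>
      left
      rw [edgeSet_fromEdgeSet]
      exact ⟨⟨c₀, .base e he hce⟩, not_isDiag_of_mem_edgeSet _ he⟩
    | some i => exact Or.inr ⟨i, (mem_edgeSet_colorClass hc₀).2 hce⟩

end Exchange

section Counting

variable {V ι : Type*} {k : ℕ} {G : SimpleGraph V}

/-- The edges of `G` joining different fibers of `p`. -/
def crossing (G : SimpleGraph V) (p : V → ι) : Set (Sym2 V) :=
  {e ∈ G.edgeSet | ∃ u ∈ e, ∃ w ∈ e, p u ≠ p w}

lemma mk_mem_crossing {p : V → ι} {u v : V} :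
    s(u, v) ∈ crossing G p ↔ G.Adj u v ∧ p u ≠ p v := by
  simp only [crossing, Set.mem_ofPred_eq, mem_edgeSet, Sym2.mem_iff]
  grind

variable [Finite V]

lemma mul_ncard_range_le {H : Fin k → SimpleGraph V} (hG : ∀ i, H i ≤ G)
    (hd : ∀ i j, i ≠ j → ∀ u v, (H i).Adj u v → ¬ (H j).Adj u v) (p : V → ι) :
    k * (Set.range p).ncard ≤
      ∑ i, numComp (H i) + {e ∈ crossing G p | ∃ i, e ∈ (H i).edgeSet}.ncard := by
  have hunion : {e ∈ crossing G p | ∃ i, e ∈ (H i).edgeSet} =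
      ⋃ i, crossing G p ∩ (H i).edgeSet := by
    ext e; simp
  have hdisj : Pairwise (Function.onFun Disjoint fun i => crossing G p ∩ (H i).edgeSet) := by
    intro i j hij
    refine Set.disjoint_left.2 fun e h h' => ?_
    induction e with | h u v
    exact hd i j hij u v h.2 h'.2
  rw [hunion, Set.ncard_iUnion_of_finite (fun _ => Set.toFinite _) hdisj, finsum_eq_sum_of_fintype,
    ← Finset.sum_add_distrib]
  have : ∀ i : Fin k, (Set.range p).ncard ≤
      numComp (H i) + (crossing G p ∩ (H i).edgeSet).ncard := by
    intro i
    have h1 : (Set.range p).ncard ≤ numComp ((H i).deleteEdges (crossing G p)) := by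
      refine ncard_range_le_numComp fun u v h => ?_
      rw [deleteEdges_adj, mk_mem_crossing] at h
      by_contra hne
      exact h.2 ⟨hG i h.1, hne⟩
    have h2 := numComp_le_add_ncard (deleteEdges_le (G := H i) (crossing G p))
    rw [edgeSet_deleteEdges, Set.sdiff_sdiff_right_self, Set.inter_comm] at h2
    omega
  calc k * (Set.range p).ncard = ∑ _i : Fin k, (Set.range p).ncard := by simp
    _ ≤ _ := Finset.sum_le_sum fun i _ => this i

lemma sum_numComp_add_ncard_crossing_le {F T : Fin k → SimpleGraph V} {R : SimpleGraph V}
    (hF : ∀ i, (F i).IsAcyclic) (hTF : ∀ i, T i ≤ F i) (hTR : ∀ i, T i ≤ R)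
    (hR : ∀ i u v, R.Adj u v → (T i).Reachable u v)
    (hcov : ∀ e ∈ G.edgeSet, e ∈ R.edgeSet ∨ ∃ i, e ∈ (F i).edgeSet) :
    ∑ i, numComp (F i) + (crossing G R.connectedComponentMk).ncard ≤
      k * (Set.range R.connectedComponentMk).ncard := by
  have hsub : crossing G R.connectedComponentMk ⊆ ⋃ i, (F i).edgeSet \ (T i).edgeSet := by
    intro e he
    induction e with | h u v
    rw [mk_mem_crossing] at he
    have hnR : ¬ R.Adj u v := fun h => he.2 (ConnectedComponent.sound h.reachable)
    obtain h | ⟨i, hi⟩ := hcov s(u, v) he.1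
    · exact absurd h hnR
    · exact Set.mem_iUnion.2 ⟨i, hi, fun h => hnR (hTR i h)⟩
  have h1 := (Set.ncard_le_ncard hsub (Set.toFinite _)).trans (Set.ncard_iUnion_le_of_fintype _)
  calc _ ≤ ∑ i, numComp (F i) + ∑ i, ((F i).edgeSet \ (T i).edgeSet).ncard := by gcongr
    _ = ∑ i, (numComp (F i) + ((F i).edgeSet \ (T i).edgeSet).ncard) :=
      Finset.sum_add_distrib.symm
    _ ≤ ∑ _i : Fin k, (Set.range R.connectedComponentMk).ncard := by
      refine Finset.sum_le_sum fun i _ => (numComp_add_ncard_le (hTF i) (hF i)).trans ?_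
      refine numComp_le_ncard_range fun u v h => ?_
      exact reachable_of_adj_reachable (hR i) (ConnectedComponent.exact h)
    _ = _ := by simp

end Counting

section TreeConnected

variable {V : Type*} {k : ℕ} {G : SimpleGraph V} {X Y : Set V}

/-- `G` has `k` edge-disjoint subgraphs with all edges inside `X`, each connecting `X`. -/
def PacksConnected (k : ℕ) (G : SimpleGraph V) (X : Set V) : Prop :=
  ∃ H : Fin k → SimpleGraph V, (∀ i, H i ≤ G) ∧ (∀ i u v, (H i).Adj u v → u ∈ X ∧ v ∈ X) ∧
    (∀ i j, i ≠ j → ∀ u v, (H i).Adj u v → ¬ (H j).Adj u v) ∧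
    ∀ i, ∀ u ∈ X, ∀ v ∈ X, (H i).Reachable u v

lemma packsConnected_of_isTreeConn (h : IsTreeConn k (G.induce X)) : PacksConnected k G X := by
  obtain ⟨T, hle, hT, hd⟩ := h
  refine ⟨fun i => (T i).map (Function.Embedding.subtype _), fun i => ?_, fun i u v h => ?_,
    fun i j hij u v h h' => ?_, fun i u hu v hv => ?_⟩
  · exact (map_le_iff_le_comap _ _ _).2 (hle i)
  · obtain ⟨-, a, b, -, rfl, rfl⟩ := h
    exact ⟨a.2, b.2⟩
  · obtain ⟨-, a, b, hab, rfl, rfl⟩ := h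
    obtain ⟨-, a', b', hab', ha, hb⟩ := h'
    obtain rfl := Subtype.ext ha
    obtain rfl := Subtype.ext hb
    exact Set.disjoint_left.1 (hd i j hij) ((mem_edgeSet _).2 hab) ((mem_edgeSet _).2 hab')
  · exact ((hT i).connected.preconnected ⟨u, hu⟩ ⟨v, hv⟩).map
      (Embedding.map (Function.Embedding.subtype _) (T i)).toHom

lemma reachable_induce {H : SimpleGraph V} (hX : ∀ u v, H.Adj u v → u ∈ X → v ∈ X) {u v : V}
    (h : H.Reachable u v) (hu : u ∈ X) (hv : v ∈ X) :
    (H.induce X).Reachable ⟨u, hu⟩ ⟨v, hv⟩ := by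
  obtain ⟨w⟩ := h
  induction w with
  | nil => rfl
  | @cons a b _ h' _ ih =>
    have hb := hX _ _ h' hu
    have hab : (H.induce X).Adj ⟨a, hu⟩ ⟨b, hb⟩ := h'
    exact hab.reachable.trans (ih hb hv)

lemma isTreeConn_induce {H : Fin k → SimpleGraph V} (hX : X.Nonempty) (hG : ∀ i, H i ≤ G)
    (hin : ∀ i u v, (H i).Adj u v → u ∈ X → v ∈ X)
    (hd : ∀ i j, i ≠ j → ∀ u v, (H i).Adj u v → ¬ (H j).Adj u v)
    (hr : ∀ i, ∀ u ∈ X, ∀ v ∈ X, (H i).Reachable u v) : IsTreeConn k (G.induce X) := by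
  have : Nonempty X := hX.to_subtype
  have hconn : ∀ i, ((H i).induce X).Connected := fun i =>
    ⟨fun u v => reachable_induce (hin i) (hr i u u.2 v v.2) u.2 v.2⟩
  choose T hTle hT using fun i => (hconn i).exists_isTree_le
  refine ⟨T, fun i u v h => hG i (hTle i h), hT, fun i j hij => ?_⟩
  refine Set.disjoint_left.2 fun e he he' => ?_
  induction e with | h u v
  exact hd i j hij u v (hTle i he) (hTle j he')

lemma isTreeConn_of_packsConnected (hX : X.Nonempty) (h : PacksConnected k G X) :
    IsTreeConn k (G.induce X) := by
  obtain ⟨H, hG, hin, hd, hr⟩ := h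
  exact isTreeConn_induce hX hG (fun i u v h _ => (hin i u v h).2) hd hr

lemma packsConnected_singleton (v : V) : PacksConnected k G {v} :=
  ⟨fun _ => ⊥, fun _ => bot_le, by simp, by simp, by rintro i u rfl w rfl; rfl⟩

lemma PacksConnected.union (hX : PacksConnected k G X) (hY : PacksConnected k G Y) {z : V}
    (hzX : z ∈ X) (hzY : z ∈ Y) : PacksConnected k G (X ∪ Y) := by
  obtain ⟨H, hG, hin, hd, hr⟩ := hX
  obtain ⟨H', hG', hin', hd', hr'⟩ := hY
  let K : Fin k → SimpleGraph V := fun i => H i ⊔ (H' i).deleteEdges {e | ∀ v ∈ e, v ∈ X}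
  have hK : ∀ i u v, (K i).Adj u v ↔ (H i).Adj u v ∨ (H' i).Adj u v ∧ ¬ (u ∈ X ∧ v ∈ X) := by
    intro i u v
    simp [K, deleteEdges_adj]
  have hHK : ∀ i, H i ≤ K i := fun i => le_sup_left
  have hrK : ∀ i, ∀ u ∈ X ∪ Y, (K i).Reachable u z := by
    rintro i u (hu | hu)
    · exact (hr i u hu z hzX).mono (hHK i)
    · refine reachable_of_adj_reachable (fun a b hab => ?_) (hr' i u hu z hzY)
      by_cases hX : a ∈ X ∧ b ∈ X
      · exact (hr i a hX.1 b hX.2).mono (hHK i)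
      · exact Adj.reachable ((hK i a b).2 (Or.inr ⟨hab, hX⟩))
  refine ⟨K, fun i => sup_le (hG i) ((deleteEdges_le _).trans (hG' i)), fun i u v h => ?_,
    fun i j hij u v h h' => ?_, fun i u hu v hv => (hrK i u hu).trans (hrK i v hv).symm⟩
  · have := hin i u v
    have := hin' i u v
    rw [hK] at h
    simp only [Set.mem_union]
    tauto
  · have := hin i u v
    have := hin j u v
    have := hd i j hij u v
    have := hd' i j hij u v
    rw [hK] at h h'
    tauto

lemma subset_mComp (hX : PacksConnected k G X) {v : V} (hv : v ∈ X) : X ⊆ mComp k G v :=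
  Set.subset_sUnion_of_mem ⟨hv, isTreeConn_of_packsConnected ⟨v, hv⟩ hX⟩

lemma self_mem_mComp (v : V) : v ∈ mComp k G v :=
  subset_mComp (packsConnected_singleton v) rfl rfl

variable [Finite V]

lemma packsConnected_mComp (v : V) : PacksConnected k G (mComp k G v) := by
  obtain ⟨X, ⟨hvX, hX⟩, hmax⟩ := (Set.toFinite {X | v ∈ X ∧ PacksConnected k G X}).exists_maximal
    ⟨{v}, rfl, packsConnected_singleton v⟩
  have : mComp k G v = X := by
    refine (Set.sUnion_subset fun Y hY => ?_).antisymm (subset_mComp hX hvX)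
    exact Set.subset_union_right.trans <| hmax
      ⟨Or.inl hvX, hX.union (packsConnected_of_isTreeConn hY.2) hvX hY.1⟩ Set.subset_union_left
  rwa [this]

lemma mComp_eq_of_mem {u v : V} (h : u ∈ mComp k G v) : mComp k G u = mComp k G v := by
  have hsub := subset_mComp (packsConnected_mComp v) h
  exact (subset_mComp (packsConnected_mComp u) (hsub (self_mem_mComp v))).antisymm hsub

lemma mComp_eq_of_packsConnected (hX : PacksConnected k G X) {u v : V} (hu : u ∈ X) (hv : v ∈ X) :
    mComp k G u = mComp k G v :=
  mComp_eq_of_mem (subset_mComp hX hv hu)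

/-- There are `k` edge-disjoint subgraphs of `G` whose components are the `k`-tree-connected
components of `G`. -/
lemma exists_spanning_mComp (k : ℕ) (G : SimpleGraph V) :
    ∃ H : Fin k → SimpleGraph V, (∀ i, H i ≤ G) ∧
      (∀ i u v, (H i).Adj u v → mComp k G u = mComp k G v) ∧
      (∀ i j, i ≠ j → ∀ u v, (H i).Adj u v → ¬ (H j).Adj u v) ∧
      ∀ i u v, mComp k G u = mComp k G v → (H i).Reachable u v := by
  have hpack : ∀ C : Set.range (mComp k G), PacksConnected k G C.1 := by
    rintro ⟨_, v, rfl⟩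
    exact packsConnected_mComp v
  choose H hG hin hd hr using hpack
  have hadj : ∀ C i u v, (H C i).Adj u v → mComp k G u = C ∧ mComp k G v = C := by
    rintro ⟨_, w, rfl⟩ i u v h
    obtain ⟨hu, hv⟩ := hin _ i u v h
    exact ⟨mComp_eq_of_mem hu, mComp_eq_of_mem hv⟩
  refine ⟨fun i => ⨆ C, H C i, fun i => iSup_le fun C => hG C i, fun i u v h => ?_,
    fun i j hij u v h h' => ?_, fun i u v huv => ?_⟩
  · obtain ⟨C, hC⟩ := iSup_adj.1 h
    obtain ⟨h1, h2⟩ := hadj C i u v hC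
    exact h1.trans h2.symm
  · obtain ⟨C, hC⟩ := iSup_adj.1 h
    obtain ⟨D, hD⟩ := iSup_adj.1 h'
    obtain rfl : C = D := Subtype.ext ((hadj C i u v hC).1.symm.trans (hadj D j u v hD).1)
    exact hd C i j hij u v hC hD
  · have hu : u ∈ mComp k G v := by
      rw [← huv]
      exact self_mem_mComp u
    exact (hr ⟨_, v, rfl⟩ i u hu v (self_mem_mComp v)).mono (le_iSup (fun C => H C i) _)

omit [Finite V] in
lemma packsConnected_setOf_reachable {T : Fin k → SimpleGraph V} {R : SimpleGraph V}
    (hG : ∀ i, T i ≤ G) (hd : ∀ i j, i ≠ j → ∀ u v, (T i).Adj u v → ¬ (T j).Adj u v)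
    (hTR : ∀ i, T i ≤ R) (hR : ∀ i u v, R.Adj u v → (T i).Reachable u v) (v : V) :
    PacksConnected k G {w | R.Reachable v w} := by
  refine packsConnected_of_isTreeConn (isTreeConn_induce ⟨v, Reachable.refl v⟩ hG ?_ hd ?_)
  · exact fun i a b h ha => Reachable.trans ha (hTR i h).reachable
  · exact fun i a ha b hb => reachable_of_adj_reachable (hR i) (ha.symm.trans hb)

/-- The partition into `k`-tree-connected components maximizes `k * |P| - e_G(P)`. -/
lemma mul_ncard_range_add_ncard_crossing_le {ι : Type*} (k : ℕ) (G : SimpleGraph V) (p : V → ι) :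
    k * (Set.range p).ncard + (crossing G (mComp k G)).ncard ≤
      k * (Set.range (mComp k G)).ncard + (crossing G p).ncard := by
  obtain ⟨F, T, R, hFG, hF, hFd, hTF, hTR, hR, hcov⟩ := exists_forests k G
  obtain ⟨H, hHG, hHin, hHd, hHr⟩ := exists_spanning_mComp k G
  have hpF := mul_ncard_range_le hFG hFd p
  have hsubF : {e ∈ crossing G p | ∃ i, e ∈ (F i).edgeSet}.ncard ≤ (crossing G p).ncard :=
    Set.ncard_le_ncard (Set.sep_subset _ _) (Set.toFinite _)
  have hFR := sum_numComp_add_ncard_crossing_le hF hTF hTR hR hcov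
  have hRH := mul_ncard_range_le hHG hHd R.connectedComponentMk
  have hHQ : ∑ i, numComp (H i) ≤ k * (Set.range (mComp k G)).ncard := by
    simpa using Finset.sum_le_sum fun i (_ : i ∈ Finset.univ) =>
      numComp_le_ncard_range (hHr i)
  have hRQ : ∀ u v, R.Reachable u v → mComp k G u = mComp k G v := fun u v h =>
    mComp_eq_of_packsConnected (packsConnected_setOf_reachable (fun i => (hTF i).trans (hFG i))
      (fun i j hij a b h h' => hFd i j hij a b (hTF i h) (hTF j h')) hTR hR u)
      (Reachable.refl u) h
  have hdisj : Disjoint (crossing G (mComp k G))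
      {e ∈ crossing G R.connectedComponentMk | ∃ i, e ∈ (H i).edgeSet} := by
    refine Set.disjoint_left.2 fun e he ⟨_, i, hi⟩ => ?_
    induction e with | h u v
    exact (mk_mem_crossing.1 he).2 (hHin i u v hi)
  have hsub : crossing G (mComp k G) ∪
      {e ∈ crossing G R.connectedComponentMk | ∃ i, e ∈ (H i).edgeSet} ⊆
      crossing G R.connectedComponentMk := by
    refine Set.union_subset (fun e he => ?_) (Set.sep_subset _ _)
    induction e with | h u v
    rw [mk_mem_crossing] at he ⊢
    exact ⟨he.1, fun h => he.2 (hRQ u v (ConnectedComponent.exact h))⟩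
  have hQ := Set.ncard_le_ncard hsub (Set.toFinite _)
  rw [Set.ncard_union_eq hdisj] at hQ
  omega

end TreeConnected

end TreePacking

theorem stmt13 {V : Type*} [Fintype V] [Nonempty V] (m : ℕ) (hm : 0 < m)
    (G : SimpleGraph V) :
    (Omega m G : ℚ) / m ≤ (Omega (m + 1) G : ℚ) / (m + 1) ∧
    (Omega m G : ℚ) / m ≤ (Fintype.card V : ℚ) := by
  have hm' : (0 : ℚ) < m := by exact_mod_cast hm
  have hcross : (0 : ℚ) ≤ crossE m G := Nat.cast_nonneg _
  constructor
  · have h := TreePacking.mul_ncard_range_add_ncard_crossing_le (m + 1) G (mComp m G)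
    change (m + 1) * (Set.range (mComp m G)).ncard + crossE (m + 1) G ≤
      (m + 1) * (Set.range (mComp (m + 1) G)).ncard + crossE m G at h
    have h' : ((m : ℚ) + 1) * (Set.range (mComp m G)).ncard + crossE (m + 1) G ≤
      (m + 1) * (Set.range (mComp (m + 1) G)).ncard + crossE m G := by exact_mod_cast h
    rw [div_le_div_iff₀ hm' (by positivity)]
    simp only [Omega]
    push_cast
    nlinarith [mul_le_mul_of_nonneg_left h' hm'.le]
  · have h : ((Set.range (mComp m G)).ncard : ℚ) ≤ Fintype.card V := by
      rw [← Nat.card_eq_fintype_card, ← Set.image_univ, ← Set.ncard_univ]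
      exact_mod_cast Set.ncard_image_le Set.finite_univ
    rw [div_le_iff₀ hm']
    simp only [Omega]
    push_cast
    nlinarith
end

section
/- Let H be a minimally m-tree-connected graph and S ⊆ V(H). Then Ω_m(H \ S) = Σ_{v∈S}(d_H(v) - m) + m - e_H(S), where H \ S is the graph obtained by deleting the vertices of S, d_H(v) is the degree of v in H, and e_H(S) is the number of edges with both ends in S. -/
open SimpleGraph

lemma ncard_edgeSet_induce {W : Type*} (G : SimpleGraph W) (X : Set W) :
    (G.induce X).edgeSet.ncard = eIn G X := by
  have h : {e ∈ G.edgeSet | ∀ v ∈ e, v ∈ X} = Sym2.map (↑) '' (G.induce X).edgeSet := by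
    ext e
    induction e with
    | h a b =>
      constructor
      · rintro ⟨hab, hX⟩
        exact ⟨s(⟨a, hX a (by simp)⟩, ⟨b, hX b (by simp)⟩), by simpa using hab, by simp⟩
      · rintro ⟨e, he, h⟩
        rw [← h]
        induction e with
        | h c d => exact ⟨by simpa using he, by simp⟩
  rw [eIn, h, Set.ncard_image_of_injective _ (Sym2.map.injective Subtype.val_injective)]

lemma SimpleGraph.IsAcyclic.exists_isTree_ge {W : Type*} [Nonempty W] {F : SimpleGraph W}
    (hF : F.IsAcyclic) : ∃ T, F ≤ T ∧ T.IsTree := by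
  obtain ⟨T, hFT, -, hT⟩ := (connected_top (V := W)).exists_isTree_le_of_le_of_isAcyclic le_top hF
  exact ⟨T, hFT, hT⟩

lemma SimpleGraph.IsTree.ncard_edgeSet {W : Type*} [Finite W] {T : SimpleGraph W}
    (hT : T.IsTree) : T.edgeSet.ncard + 1 = Nat.card W := by
  rw [← (isTree_iff_connected_and_card.1 hT).2, Nat.card_coe_set_eq]

lemma SimpleGraph.IsAcyclic.ncard_edgeSet_le {W : Type*} [Finite W] [Nonempty W]
    {F : SimpleGraph W} (hF : F.IsAcyclic) : F.edgeSet.ncard + 1 ≤ Nat.card W := by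
  obtain ⟨T, hFT, hT⟩ := hF.exists_isTree_ge
  rw [← hT.ncard_edgeSet]
  gcongr
  · exact Set.toFinite _

lemma SimpleGraph.IsAcyclic.isTree_of_le_ncard_edgeSet {W : Type*} [Finite W] [Nonempty W]
    {F : SimpleGraph W} (hF : F.IsAcyclic) (h : Nat.card W ≤ F.edgeSet.ncard + 1) :
    F.IsTree := by
  obtain ⟨T, hFT, hT⟩ := hF.exists_isTree_ge
  have := hT.ncard_edgeSet
  have hE := Set.eq_of_subset_of_ncard_le (edgeSet_subset_edgeSet.2 hFT) (by omega)
    (Set.toFinite _)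
  rwa [edgeSet_inj.1 hE]

lemma ncard_iUnion_eq_sum {ι α : Type*} [Fintype ι] [Finite α] (s : ι → Set α)
    (hs : ∀ i j, i ≠ j → Disjoint (s i) (s j)) :
    (⋃ i, s i).ncard = ∑ i, (s i).ncard := by
  rw [Set.ncard_iUnion_of_finite (fun i => Set.toFinite _) (fun i j h => hs i j h),
    finsum_eq_sum_of_fintype]

/-- The edges of `G` are partitioned into the `m` forests `F i`. -/
structure IsForestPartition {W : Type*} {m : ℕ} (G : SimpleGraph W) (F : Fin m → SimpleGraph W) :
    Prop where
  acyclic : ∀ i, (F i).IsAcyclic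
  disjoint : ∀ i j, i ≠ j → Disjoint (F i).edgeSet (F j).edgeSet
  edgeSet_eq : G.edgeSet = ⋃ i, (F i).edgeSet

namespace IsForestPartition

variable {W : Type*} {m : ℕ} {G : SimpleGraph W} {F : Fin m → SimpleGraph W}

lemma le (h : IsForestPartition G F) (i : Fin m) : F i ≤ G := by
  rw [← edgeSet_subset_edgeSet, h.edgeSet_eq]
  exact Set.subset_iUnion (fun i => (F i).edgeSet) i

lemma induce (h : IsForestPartition G F) (X : Set W) :
    IsForestPartition (G.induce X) fun i => (F i).induce X where
  acyclic i := (h.acyclic i).induce X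
  disjoint i j hij := by
    rw [Set.disjoint_left]
    intro e
    induction e with
    | h a b =>
      have : s(a.1, b.1) ∈ (F i).edgeSet → s(a.1, b.1) ∉ (F j).edgeSet :=
        fun ha => Set.disjoint_left.1 (h.disjoint i j hij) ha
      simpa using this
  edgeSet_eq := by
    ext e
    induction e with
    | h a b =>
      have := Set.ext_iff.1 h.edgeSet_eq s(a.1, b.1)
      simpa using this

variable [Finite W]

lemma eIn_eq_sum (h : IsForestPartition G F) (X : Set W) : eIn G X = ∑ i, eIn (F i) X := by
  have := ncard_iUnion_eq_sum (fun i => {e ∈ (F i).edgeSet | ∀ v ∈ e, v ∈ X})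
    (fun i j hij => (h.disjoint i j hij).mono (Set.sep_subset _ _) (Set.sep_subset _ _))
  simp only [eIn]
  rw [← this, h.edgeSet_eq]
  congr 1
  ext e
  simp

lemma eIn_forest_le (h : IsForestPartition G F) {X : Set W} (hX : X.Nonempty) (i : Fin m) :
    eIn (F i) X + 1 ≤ X.ncard := by
  have := hX.to_subtype
  rw [← ncard_edgeSet_induce, ← Nat.card_coe_set_eq X]
  exact ((h.acyclic i).induce X).ncard_edgeSet_le

lemma eIn_add_le (h : IsForestPartition G F) {X : Set W} (hX : X.Nonempty) :
    eIn G X + m ≤ m * X.ncard := by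
  have := Finset.sum_le_sum fun i (_ : i ∈ Finset.univ) => h.eIn_forest_le hX i
  simpa [Finset.sum_add_distrib, ← h.eIn_eq_sum] using this

lemma isTreeConn_induce_iff (h : IsForestPartition G F) {X : Set W} (hX : X.Nonempty) :
    IsTreeConn m (G.induce X) ↔ eIn G X + m = m * X.ncard := by
  have hne := hX.to_subtype
  constructor
  · rintro ⟨T, hle, hT, hd⟩
    refine (h.eIn_add_le hX).antisymm ?_
    have hsub : (⋃ i, (T i).edgeSet) ⊆ (G.induce X).edgeSet :=
      Set.iUnion_subset fun i => edgeSet_subset_edgeSet.2 (hle i)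
    have hcard := Set.ncard_le_ncard hsub (Set.toFinite _)
    rw [ncard_iUnion_eq_sum _ hd, ncard_edgeSet_induce] at hcard
    have hsum : ∑ i, ((T i).edgeSet.ncard + 1) = m * X.ncard := by
      simp [fun i => (hT i).ncard_edgeSet]
    simp only [Finset.sum_add_distrib, Finset.sum_const, Finset.card_univ, Fintype.card_fin,
      smul_eq_mul, mul_one] at hsum
    omega
  · intro heq
    have hsum : ∑ i, (eIn (F i) X + 1) = ∑ _i : Fin m, X.ncard := by
      simpa [Finset.sum_add_distrib, ← h.eIn_eq_sum] using heq
    have hi := (Finset.sum_eq_sum_iff_of_le fun i _ => h.eIn_forest_le hX i).1 hsum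
    refine ⟨fun i => (F i).induce X, (h.induce X).le, fun i => ?_, (h.induce X).disjoint⟩
    refine ((h.acyclic i).induce X).isTree_of_le_ncard_edgeSet ?_
    rw [ncard_edgeSet_induce, hi i (Finset.mem_univ i), Nat.card_coe_set_eq]

end IsForestPartition

lemma eIn_add_eIn_le {W : Type*} [Finite W] (G : SimpleGraph W) (X Y : Set W) :
    eIn G X + eIn G Y ≤ eIn G (X ∪ Y) + eIn G (X ∩ Y) := by
  simp only [eIn]
  rw [← Set.ncard_union_add_ncard_inter _ _ (Set.toFinite _) (Set.toFinite _)]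
  gcongr
  · exact Set.toFinite _
  · rintro e (⟨he, h⟩ | ⟨he, h⟩)
    · exact ⟨he, fun v hv => .inl (h v hv)⟩
    · exact ⟨he, fun v hv => .inr (h v hv)⟩
  · exact Set.toFinite _
  · rintro e ⟨⟨he, h⟩, -, h'⟩
    exact ⟨he, fun v hv => ⟨h v hv, h' v hv⟩⟩

namespace IsForestPartition

variable {W : Type*} [Finite W] {m : ℕ} {G : SimpleGraph W} {F : Fin m → SimpleGraph W}

lemma isTreeConn_induce_union (h : IsForestPartition G F) {X Y : Set W}
    (hXY : (X ∩ Y).Nonempty) (hX : IsTreeConn m (G.induce X)) (hY : IsTreeConn m (G.induce Y)) :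
    IsTreeConn m (G.induce (X ∪ Y)) := by
  rw [h.isTreeConn_induce_iff (hXY.mono Set.inter_subset_left)] at hX
  rw [h.isTreeConn_induce_iff (hXY.mono Set.inter_subset_right)] at hY
  have hU : (X ∪ Y).Nonempty := hXY.mono (Set.inter_subset_left.trans Set.subset_union_left)
  rw [h.isTreeConn_induce_iff hU]
  have hsub := eIn_add_eIn_le G X Y
  have hU' := h.eIn_add_le hU
  have hI' := h.eIn_add_le hXY
  have hcard := congrArg (m * ·)
    (Set.ncard_union_add_ncard_inter X Y (Set.toFinite _) (Set.toFinite _))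
  simp only [mul_add] at hcard
  omega

lemma isTreeConn_induce_singleton (h : IsForestPartition G F) (v : W) :
    IsTreeConn m (G.induce {v}) := by
  rw [h.isTreeConn_induce_iff (Set.singleton_nonempty v)]
  have := h.eIn_add_le (Set.singleton_nonempty v)
  simp only [Set.ncard_singleton, mul_one] at this ⊢
  omega

lemma mem_mComp (h : IsForestPartition G F) (v : W) : v ∈ mComp m G v :=
  ⟨{v}, ⟨rfl, h.isTreeConn_induce_singleton v⟩, rfl⟩

lemma isTreeConn_induce_mComp (h : IsForestPartition G F) (v : W) :
    IsTreeConn m (G.induce (mComp m G v)) := by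
  have hne : {X : Set W | v ∈ X ∧ IsTreeConn m (G.induce X)}.Nonempty :=
    ⟨{v}, rfl, h.isTreeConn_induce_singleton v⟩
  obtain ⟨M, hM⟩ := (Set.toFinite _).exists_maximal hne
  have hMv : mComp m G v = M := by
    refine (Set.sUnion_subset fun X hX => ?_).antisymm (Set.subset_sUnion_of_mem hM.prop)
    have hU := h.isTreeConn_induce_union ⟨v, hX.1, hM.prop.1⟩ hX.2 hM.prop.2
    have hXM : X ∪ M ∈ {X : Set W | v ∈ X ∧ IsTreeConn m (G.induce X)} := ⟨.inl hX.1, hU⟩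
    exact Set.subset_union_left.trans (hM.le_of_ge hXM Set.subset_union_right)
  rw [hMv]
  exact hM.prop.2

lemma mComp_eq_of_mem (h : IsForestPartition G F) {v w : W} (hw : w ∈ mComp m G v) :
    mComp m G w = mComp m G v := by
  have hvw : mComp m G v ⊆ mComp m G w :=
    Set.subset_sUnion_of_mem ⟨hw, h.isTreeConn_induce_mComp v⟩
  have hwv : mComp m G w ⊆ mComp m G v :=
    Set.subset_sUnion_of_mem ⟨hvw (h.mem_mComp v), h.isTreeConn_induce_mComp w⟩
  exact hwv.antisymm hvw

lemma mem_mComp_iff (h : IsForestPartition G F) {v w : W} :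
    w ∈ mComp m G v ↔ mComp m G w = mComp m G v :=
  ⟨h.mComp_eq_of_mem, fun hw => hw ▸ h.mem_mComp w⟩

lemma disjoint_of_mem_range_mComp (h : IsForestPartition G F) {C D : Set.range (mComp m G)}
    (hCD : C ≠ D) : Disjoint C.1 D.1 := by
  obtain ⟨_, v, rfl⟩ := C
  obtain ⟨_, w, rfl⟩ := D
  rw [Set.disjoint_left]
  intro x hx hx'
  exact hCD (Subtype.ext ((h.mComp_eq_of_mem hx).symm.trans (h.mComp_eq_of_mem hx')))

lemma edgeSet_ncard (h : IsForestPartition G F) :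
    G.edgeSet.ncard + m * (Set.range (mComp m G)).ncard = crossE m G + m * Nat.card W := by
  classical
  have := Fintype.ofFinite (Set.range (mComp m G))
  have hW : ∑ C : Set.range (mComp m G), C.1.ncard = Nat.card W := by
    rw [← ncard_iUnion_eq_sum _ fun C D hCD => h.disjoint_of_mem_range_mComp hCD,
      ← Set.ncard_univ]
    congr 1
    exact Set.eq_univ_of_forall fun v =>
      Set.mem_iUnion.2 ⟨⟨_, v, rfl⟩, h.mem_mComp v⟩
  have hin : ∑ C : Set.range (mComp m G), eIn G C.1 =
      {e ∈ G.edgeSet | ¬ ∃ u ∈ e, ∃ w ∈ e, mComp m G u ≠ mComp m G w}.ncard := by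
    simp only [eIn]
    rw [← ncard_iUnion_eq_sum]
    · congr 1
      ext e
      simp only [Set.mem_iUnion, Set.mem_ofPred_eq]
      constructor
      · rintro ⟨⟨_, v, rfl⟩, he, hv⟩
        refine ⟨he, ?_⟩
        rintro ⟨u, hu, w, hw, huw⟩
        exact huw ((h.mComp_eq_of_mem (hv u hu)).trans (h.mComp_eq_of_mem (hv w hw)).symm)
      · rintro ⟨he, hne⟩
        push Not at hne
        induction e with
        | h a b =>
          exact ⟨⟨_, a, rfl⟩, he, fun v hv => h.mem_mComp_iff.2 (hne v hv a (by simp))⟩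
    · intro C D hCD
      rw [Set.disjoint_left]
      rintro e ⟨-, hC⟩ ⟨-, hD⟩
      induction e with
      | h a b =>
        exact Set.disjoint_left.1 (h.disjoint_of_mem_range_mComp hCD)
          (hC a (by simp)) (hD a (by simp))
  have htight : ∑ C : Set.range (mComp m G), (eIn G C.1 + m) =
      ∑ C : Set.range (mComp m G), m * C.1.ncard := by
    refine Finset.sum_congr rfl ?_
    rintro ⟨_, v, rfl⟩ -
    exact (h.isTreeConn_induce_iff ⟨v, h.mem_mComp v⟩).1 (h.isTreeConn_induce_mComp v)
  rw [Finset.sum_add_distrib, ← Finset.mul_sum, hW, hin, Finset.sum_const, Finset.card_univ,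
    ← Nat.card_eq_fintype_card, Nat.card_coe_set_eq, smul_eq_mul] at htight
  have hsplit : crossE m G +
      {e ∈ G.edgeSet | ¬ ∃ u ∈ e, ∃ w ∈ e, mComp m G u ≠ mComp m G w}.ncard =
      G.edgeSet.ncard := by
    rw [crossE, ← Set.ncard_union_eq _ (Set.toFinite _) (Set.toFinite _)]
    · congr 1
      ext e
      simp only [Set.mem_union, Set.mem_ofPred_eq]
      exact ⟨fun h => h.elim And.left And.left, fun he => (em _).imp (⟨he, ·⟩) (⟨he, ·⟩)⟩
    · exact Set.disjoint_left.2 fun e he he' => he'.2 he.2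
  have := mul_comm m (Set.range (mComp m G)).ncard
  omega

lemma omega_eq (h : IsForestPartition G F) :
    Omega m G = m * (Nat.card W : ℤ) - G.edgeSet.ncard := by
  have := h.edgeSet_ncard
  zify at this
  rw [Omega]
  linarith

end IsForestPartition

lemma sum_ncard_neighborSet_add {V : Type*} [Fintype V] (H : SimpleGraph V) (S : Finset V) :
    (∑ v ∈ S, (H.neighborSet v).ncard) + eIn H (↑S : Set V)ᶜ =
      H.edgeSet.ncard + eIn H ↑S := by
  classical
  have hdeg (v : V) : (H.neighborSet v).ncard = ∑ e ∈ H.edgeFinset, if v ∈ e then 1 else 0 := by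
    rw [← Finset.card_filter, ← incidenceFinset_eq_filter, card_incidenceFinset_eq_degree,
      Set.ncard_eq_toFinset_card', ← card_neighborFinset_eq_degree]
    rfl
  have heIn (X : Set V) : eIn H X = ∑ e ∈ H.edgeFinset, if ∀ v ∈ e, v ∈ X then 1 else 0 := by
    rw [← Finset.card_filter, eIn, ← Set.ncard_coe_finset]
    simp
  have hE : H.edgeSet.ncard = ∑ e ∈ H.edgeFinset, 1 := by
    rw [← Finset.card_eq_sum_ones, ← Set.ncard_coe_finset, coe_edgeFinset]
  simp_rw [hdeg]
  rw [Finset.sum_comm, heIn, heIn, hE, ← Finset.sum_add_distrib, ← Finset.sum_add_distrib]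
  refine Finset.sum_congr rfl fun e he => ?_
  induction e with
  | h a b =>
    have hab : a ≠ b := H.ne_of_adj (by simpa using he)
    have hsum : (∑ v ∈ S, if v ∈ s(a, b) then 1 else 0) =
        (if a ∈ S then 1 else 0) + if b ∈ S then 1 else 0 := by
      rw [← Finset.sum_ite_eq' S a fun _ => 1, ← Finset.sum_ite_eq' S b fun _ => 1,
        ← Finset.sum_add_distrib]
      refine Finset.sum_congr rfl fun v _ => ?_
      simp only [Sym2.mem_iff]
      split_ifs <;> grind
    rw [hsum]
    by_cases ha : a ∈ S <;> by_cases hb : b ∈ S <;> simp [ha, hb]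

lemma IsTreeConn.exists_isForestPartition {V : Type*} [Finite V] {m : ℕ} {H : SimpleGraph V}
    (h : IsTreeConn m H) (hcard : H.edgeSet.ncard + m = m * Nat.card V) :
    ∃ F : Fin m → SimpleGraph V, IsForestPartition H F := by
  obtain ⟨T, hle, hT, hd⟩ := h
  refine ⟨T, fun i => (hT i).isAcyclic, hd, ?_⟩
  have hsub : (⋃ i, (T i).edgeSet) ⊆ H.edgeSet :=
    Set.iUnion_subset fun i => edgeSet_subset_edgeSet.2 (hle i)
  refine (Set.eq_of_subset_of_ncard_le hsub ?_ (Set.toFinite _)).symm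
  rw [ncard_iUnion_eq_sum _ hd]
  have hsum : ∑ i, ((T i).edgeSet.ncard + 1) = m * Nat.card V := by
    simp [fun i => (hT i).ncard_edgeSet]
  simp only [Finset.sum_add_distrib, Finset.sum_const, Finset.card_univ, Fintype.card_fin,
    smul_eq_mul, mul_one] at hsum
  omega

theorem stmt14 {V : Type*} [Fintype V] (m : ℕ) (hm : 0 < m) (H : SimpleGraph V)
    (htc : IsTreeConn m H)
    (hmin : (H.edgeSet.ncard : ℤ) = m * ((Fintype.card V : ℤ) - 1))
    (S : Finset V) :
    Omega m (H.induce ((↑S : Set V)ᶜ)) =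
      (∑ v ∈ S, (((H.neighborSet v).ncard : ℤ) - m)) + m - (eIn H ↑S : ℤ) := by
  have hcard : H.edgeSet.ncard + m = m * Nat.card V := by
    zify
    rw [Nat.card_eq_fintype_card, hmin]
    ring
  obtain ⟨F, hF⟩ := htc.exists_isForestPartition hcard
  rw [(hF.induce (↑S : Set V)ᶜ).omega_eq, ncard_edgeSet_induce, Nat.card_coe_set_eq]
  have hcompl := Set.ncard_add_ncard_compl (↑S : Set V)
  rw [Set.ncard_coe_finset, Nat.card_eq_fintype_card] at hcompl
  have hsum := sum_ncard_neighborSet_add H S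
  zify at hcompl hsum
  rw [Finset.sum_sub_distrib, Finset.sum_const, nsmul_eq_mul]
  linear_combination (m : ℤ) * hcompl - hsum - hmin
end

section
/- Every connected graph G of order at least two with Q ⊆ V(G) of even cardinality has a spanning forest F such that Q is exactly the set of vertices of odd degree in F. -/
open SimpleGraph

open Classical in
/-- The degree of each vertex, reduced modulo two. -/
noncomputable def SimpleGraph.degParity {V : Type*} [Fintype V] (F : SimpleGraph V) (v : V) :
    ZMod 2 :=
  ∑ x, if F.Adj v x then 1 else 0

lemma SimpleGraph.degParity_eq_ncard {V : Type*} [Fintype V] (F : SimpleGraph V) (v : V) :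
    F.degParity v = ((F.neighborSet v).ncard : ZMod 2) := by
  classical
  rw [Set.ncard_eq_toFinset_card', degParity, Finset.sum_boole]
  congr 2
  ext x
  simp

lemma SimpleGraph.degParity_symmDiff {V : Type*} [Fintype V] (F H : SimpleGraph V) :
    (symmDiff F H).degParity = F.degParity + H.degParity := by
  classical
  funext v
  simp only [degParity, Pi.add_apply, ← Finset.sum_add_distrib]
  refine Finset.sum_congr rfl fun x _ => ?_
  have h2 : (1 : ZMod 2) + 1 = 0 := by decide
  by_cases hF : F.Adj v x <;> by_cases hH : H.Adj v x <;> simp [symmDiff, hF, hH, h2]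

open Classical in
lemma SimpleGraph.degParity_edge {V : Type*} [Fintype V] {u v : V} (h : u ≠ v) :
    (edge u v).degParity = Pi.single u 1 + Pi.single v 1 := by
  funext w
  have key : ∀ x, (if (edge u v).Adj w x then (1 : ZMod 2) else 0) =
      (if x = v then (if w = u then 1 else 0) else 0) +
        (if x = u then (if w = v then 1 else 0) else 0) := by
    intro x
    simp only [edge_adj]
    split_ifs <;> simp_all
  calc (edge u v).degParity w
      = ∑ x, ((if x = v then (if w = u then (1 : ZMod 2) else 0) else 0) +
          (if x = u then (if w = v then 1 else 0) else 0)) :=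
        Finset.sum_congr rfl fun x _ => by convert key x
    _ = _ := by
      simp only [Finset.sum_add_distrib, Finset.sum_ite_eq', Finset.mem_univ, if_true,
        Pi.add_apply, Pi.single_apply]

lemma Pi.zmod_two_add_self {V : Type*} (f : V → ZMod 2) : f + f = 0 :=
  funext fun v => CharTwo.add_self_eq_zero (f v)

/-- The vectors of degree parities realised by the spanning subgraphs of `G`. -/
def SimpleGraph.parityVectors {V : Type*} [Fintype V] (G : SimpleGraph V) :
    AddSubmonoid (V → ZMod 2) where
  carrier := {f | ∃ F ≤ G, F.degParity = f}
  zero_mem' := ⟨⊥, bot_le, by funext v; simp [degParity]⟩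
  add_mem' := by
    rintro _ _ ⟨F, hF, rfl⟩ ⟨H, hH, rfl⟩
    exact ⟨symmDiff F H, symmDiff_le_sup.trans (sup_le hF hH), degParity_symmDiff F H⟩

open Classical in
lemma SimpleGraph.Reachable.single_add_single_mem_parityVectors {V : Type*} [Fintype V]
    {G : SimpleGraph V} {u v : V} (h : G.Reachable u v) :
    (Pi.single u 1 + Pi.single v 1 : V → ZMod 2) ∈ G.parityVectors := by
  obtain ⟨p⟩ := h
  induction p with
  | nil => rw [Pi.zmod_two_add_self]; exact zero_mem _
  | @cons u v w huv p ih =>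
    have hedge : (Pi.single u 1 + Pi.single v 1 : V → ZMod 2) ∈ G.parityVectors :=
      ⟨edge u v, by rwa [edge_le_iff, or_iff_right huv.ne], degParity_edge huv.ne⟩
    have := add_mem hedge ih
    rwa [add_assoc, ← add_assoc (Pi.single v 1), Pi.zmod_two_add_self, zero_add] at this

open Classical in
lemma SimpleGraph.Connected.sum_single_mem_parityVectors {V : Type*} [Fintype V]
    {G : SimpleGraph V} (hG : G.Connected) {Q : Finset V} (hQ : Even Q.card) :
    (∑ q ∈ Q, Pi.single q 1 : V → ZMod 2) ∈ G.parityVectors := by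
  obtain ⟨r⟩ := hG.nonempty
  have h : (∑ q ∈ Q, (Pi.single q 1 + Pi.single r 1) : V → ZMod 2) ∈ G.parityVectors :=
    sum_mem fun q _ => (hG q r).single_add_single_mem_parityVectors
  obtain ⟨k, hk⟩ := hQ
  rwa [Finset.sum_add_distrib, Finset.sum_const, hk, add_nsmul, Pi.zmod_two_add_self,
    add_zero] at h

theorem stmt17 {V : Type*} [Fintype V] (G : SimpleGraph V) (hG : G.Connected)
    (hV : 2 ≤ Fintype.card V) (Q : Finset V) (hQ : Even Q.card) :
    ∃ F : SimpleGraph V, F ≤ G ∧ F.IsAcyclic ∧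
      ∀ v : V, v ∈ Q ↔ Odd (F.neighborSet v).ncard := by
  classical
  obtain ⟨T, hTG, hT⟩ := hG.exists_isTree_le
  obtain ⟨F, hFT, hF⟩ := hT.connected.sum_single_mem_parityVectors hQ
  refine ⟨F, hFT.trans hTG, hT.isAcyclic.anti hFT, fun v => ?_⟩
  rw [← ZMod.natCast_eq_one_iff_odd, ← F.degParity_eq_ncard, hF, Finset.sum_apply]
  simp [Pi.single_apply]
end
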